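/- arXiv:2007.03957 — 4 statements merged into one kernel-verified Lean document; each statement's English description precedes it below -/
import Mathlib

section
/- For every positive integer s, the convergent series ∑_{n=1}^∞ (-1)^n/(n^s · 2^n · binom(2n,n)) belongs to CMZV²_s, the ℚ-linear span in ℂ of colored multiple zeta values of level 2 and weight s. -/
open scoped BigOperators

/-- Partial multiple sum `∑_{M ≥ n₁ > ⋯ > n_k ≥ 1} ∏ᵢ aᵢ^{nᵢ} / nᵢ^{sᵢ}`. -/
noncomputable def multiplePartialSum (k : ℕ) (s : Fin k → ℕ) (a : Fin k → ℂ) (M : ℕ) : ℂ :=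
  ∑ n : Fin k → Fin (M + 1),
    if (∀ i j : Fin k, i < j → (n j : ℕ) < (n i : ℕ)) ∧ (∀ i, 0 < (n i : ℕ)) then
      ∏ i, (a i) ^ (n i : ℕ) / ((n i : ℕ) : ℂ) ^ (s i)
    else 0

/-- `z` is a colored multiple zeta value of level `N` and weight `w`:
`z = ∑_{n₁ > ⋯ > n_k ≥ 1} a₁^{n₁} ⋯ a_k^{n_k} / (n₁^{s₁} ⋯ n_k^{s_k})` (as a limit of the
partial sums over `M ≥ n₁ > ⋯ > n_k ≥ 1` as `M → ∞`), where the `sᵢ` are positive integers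
with `s₁ + ⋯ + s_k = w`, each `aᵢ` is an `N`-th root of unity, and `(s₁, a₁) ≠ (1, 1)`. -/
def IsCMZV (N w : ℕ) (z : ℂ) : Prop :=
  ∃ (k : ℕ) (hk : 0 < k) (s : Fin k → ℕ) (a : Fin k → ℂ),
    (∀ i, 0 < s i) ∧ (∑ i, s i) = w ∧ (∀ i, (a i) ^ N = 1) ∧
    ¬(s ⟨0, hk⟩ = 1 ∧ a ⟨0, hk⟩ = 1) ∧
    Filter.Tendsto (multiplePartialSum k s a) Filter.atTop (nhds z)

/-- The ℚ-linear span in ℂ of the colored multiple zeta values of level `N` and weight `w`. -/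
noncomputable def CMZV (N w : ℕ) : Submodule ℚ ℂ :=
  Submodule.span ℚ {z : ℂ | IsCMZV N w z}

/-- The multiple harmonic number `H_n^{(t₁,…,t_m)} = ∑_{n ≥ n₁ > ⋯ > n_m ≥ 1} ∏ᵢ 1/nᵢ^{tᵢ}`;
it equals `1` for the empty tuple. -/
noncomputable def multiHarmonic {m : ℕ} (t : Fin m → ℕ) (n : ℕ) : ℝ :=
  ∑ x : Fin m → Fin (n + 1),
    if (∀ i j : Fin m, i < j → (x j : ℕ) < (x i : ℕ)) ∧ (∀ i, 0 < (x i : ℕ)) then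
      ∏ i, 1 / ((x i : ℕ) : ℝ) ^ (t i)
    else 0

/-- The tuples `M ≥ n₁ > ⋯ > n_k ≥ 1`. -/
def decreasingTuples (k M : ℕ) : Finset (Fin k → ℕ) :=
  {x ∈ Fintype.piFinset fun _ : Fin k => Finset.range (M + 1) |
    (∀ i j : Fin k, i < j → x j < x i) ∧ ∀ i, 0 < x i}

lemma mem_decreasingTuples {k M : ℕ} {x : Fin k → ℕ} :
    x ∈ decreasingTuples k M ↔
      (∀ i, x i ≤ M) ∧ (∀ i j : Fin k, i < j → x j < x i) ∧ ∀ i, 0 < x i := by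
  simp [decreasingTuples, Fintype.mem_piFinset]

lemma multiplePartialSum_eq_sum_decreasingTuples (k : ℕ) (s : Fin k → ℕ) (a : Fin k → ℂ) (M : ℕ) :
    multiplePartialSum k s a M =
      ∑ x ∈ decreasingTuples k M, ∏ i, a i ^ x i / (x i : ℂ) ^ s i := by
  rw [multiplePartialSum, decreasingTuples, Finset.sum_filter]
  refine Finset.sum_bij (fun n _ i => (n i : ℕ)) ?_ ?_ ?_ ?_
  · intro n _
    simp only [Fintype.mem_piFinset, Finset.mem_range]
    exact fun i => (n i).2
  · intro n _ m _ h
    funext i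
    exact Fin.ext (congrFun h i)
  · intro x hx
    simp only [Fintype.mem_piFinset, Finset.mem_range] at hx
    exact ⟨fun i => ⟨x i, hx i⟩, Finset.mem_univ _, rfl⟩
  · intro n _
    rfl

lemma multiplePartialSum_zero (s : Fin 0 → ℕ) (a : Fin 0 → ℂ) (M : ℕ) :
    multiplePartialSum 0 s a M = 1 := by
  simp [multiplePartialSum]

lemma multiplePartialSum_succ (k : ℕ) (s : Fin (k + 1) → ℕ) (a : Fin (k + 1) → ℂ) (M : ℕ) :
    multiplePartialSum (k + 1) s a M =
      ∑ m ∈ Finset.range M, a 0 ^ (m + 1) / ((m + 1 : ℕ) : ℂ) ^ s 0 *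
        multiplePartialSum k (Fin.tail s) (Fin.tail a) m := by
  simp only [multiplePartialSum_eq_sum_decreasingTuples, Finset.mul_sum]
  rw [Finset.sum_sigma']
  refine Finset.sum_bij' (fun x _ => ⟨x 0 - 1, Fin.tail x⟩) (fun p _ => Fin.cons (p.1 + 1) p.2)
    ?_ ?_ ?_ ?_ ?_
  · intro x hx
    rw [mem_decreasingTuples] at hx
    obtain ⟨h1, h2, h3⟩ := hx
    simp only [Finset.mem_sigma, Finset.mem_range, mem_decreasingTuples, Fin.tail]
    refine ⟨?_, fun i => ?_, fun i j hij => h2 _ _ (Fin.succ_lt_succ_iff.2 hij), fun i => h3 _⟩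
    · have := h1 0
      have := h3 0
      omega
    · have := h2 0 i.succ (Fin.succ_pos i)
      omega
  · rintro ⟨m, x⟩ hx
    simp only [Finset.mem_sigma, Finset.mem_range, mem_decreasingTuples] at hx
    obtain ⟨hm, h1, h2, h3⟩ := hx
    rw [mem_decreasingTuples]
    refine ⟨fun i => ?_, fun i j hij => ?_, fun i => ?_⟩
    · refine Fin.cases ?_ (fun i => ?_) i
      · simpa using hm
      · have := h1 i
        simp only [Fin.cons_succ]
        omega
    · revert hij
      refine Fin.cases ?_ (fun j => ?_) j
      · intro hij
        exact absurd hij (Fin.not_lt_zero i)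
      · refine Fin.cases ?_ (fun i => ?_) i
        · intro _
          simpa [Nat.lt_succ_iff] using h1 j
        · intro hij
          simpa using h2 i j (Fin.succ_lt_succ_iff.1 hij)
    · refine Fin.cases ?_ (fun i => ?_) i
      · simp
      · simpa using h3 i
  · intro x hx
    rw [mem_decreasingTuples] at hx
    have := hx.2.2 0
    dsimp only
    rw [Nat.sub_add_cancel this, Fin.cons_self_tail]
  · rintro ⟨m, x⟩ _
    simp
  · intro x hx
    rw [mem_decreasingTuples] at hx
    have := hx.2.2 0
    dsimp only
    rw [Nat.sub_add_cancel this, Fin.prod_univ_succ]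
    rfl

/-- The sum `∑_{M ≥ n₁ > ⋯ > n_k ≥ 1} ∏ᵢ 1 / nᵢ ^ (lᵢ + 1)`. -/
noncomputable def nestedSum : List ℕ → ℕ → ℝ
  | [], _ => 1
  | t :: l, M => ∑ m ∈ Finset.range M, nestedSum l m / ((m : ℝ) + 1) ^ (t + 1)

lemma nestedSum_nil (M : ℕ) : nestedSum [] M = 1 := rfl

lemma nestedSum_cons (t : ℕ) (l : List ℕ) (M : ℕ) :
    nestedSum (t :: l) M = ∑ m ∈ Finset.range M, nestedSum l m / ((m : ℝ) + 1) ^ (t + 1) := rfl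

lemma nestedSum_cons_zero (t : ℕ) (l : List ℕ) : nestedSum (t :: l) 0 = 0 := by
  simp [nestedSum_cons]

lemma nestedSum_cons_succ (t : ℕ) (l : List ℕ) (M : ℕ) :
    nestedSum (t :: l) (M + 1) =
      nestedSum (t :: l) M + nestedSum l M / ((M : ℝ) + 1) ^ (t + 1) := by
  simp [nestedSum_cons, Finset.sum_range_succ]

lemma multiplePartialSum_one (l : List ℕ) (M : ℕ) :
    multiplePartialSum l.length (fun i => l.get i + 1) (fun _ => 1) M = nestedSum l M := by
  induction l generalizing M with
  | nil => exact_mod_cast multiplePartialSum_zero _ _ M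
  | cons t l ih =>
    refine (multiplePartialSum_succ l.length _ _ M).trans ?_
    rw [nestedSum_cons]
    push_cast
    refine Finset.sum_congr rfl fun m _ => ?_
    rw [← ih m, div_mul_eq_mul_div]
    simp only [one_pow, one_mul]
    rfl

lemma multiplePartialSum_cons_neg_one (t : ℕ) (l : List ℕ) (M : ℕ) :
    multiplePartialSum (l.length + 1) (Fin.cons (t + 1) fun i => l.get i + 1)
        (Fin.cons (-1) fun _ => 1) M =
      ((∑ m ∈ Finset.range M, nestedSum l m / ((m : ℝ) + 1) ^ (t + 1) * (-1) ^ (m + 1) : ℝ) : ℂ) := by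
  rw [multiplePartialSum_succ]
  push_cast
  refine Finset.sum_congr rfl fun m _ => ?_
  rw [Fin.tail_cons, Fin.tail_cons, multiplePartialSum_one, Fin.cons_zero, Fin.cons_zero]
  ring

lemma nestedSum_nonneg (l : List ℕ) (M : ℕ) : 0 ≤ nestedSum l M := by
  induction l generalizing M with
  | nil => simp [nestedSum_nil]
  | cons t l ih =>
    rw [nestedSum_cons]
    exact Finset.sum_nonneg fun m _ => div_nonneg (ih m) (by positivity)

lemma nestedSum_le_harmonic_pow (l : List ℕ) (M : ℕ) :
    nestedSum l M ≤ (harmonic M : ℝ) ^ l.length := by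
  induction l generalizing M with
  | nil => simp [nestedSum_nil]
  | cons t l ih =>
    have hH : ∀ n : ℕ, (harmonic n : ℝ) = ∑ i ∈ Finset.range n, ((i : ℝ) + 1)⁻¹ := fun n => by
      simp [harmonic]
    have h0 : ∀ n : ℕ, (0 : ℝ) ≤ harmonic n := fun n => by
      rw [hH]; positivity
    rw [nestedSum_cons, List.length_cons, pow_succ]
    refine le_of_le_of_eq ?_ (congrArg ((harmonic M : ℝ) ^ l.length * ·) (hH M).symm)
    rw [Finset.mul_sum]
    refine Finset.sum_le_sum fun m hm => ?_
    rw [div_eq_mul_inv]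
    refine mul_le_mul ((ih m).trans (pow_le_pow_left₀ (h0 m) ?_ _)) ?_ (by positivity)
      (pow_nonneg (h0 M) _)
    · rw [hH, hH]
      refine Finset.sum_le_sum_of_subset_of_nonneg ?_ fun i _ _ => by positivity
      exact Finset.range_subset_range.2 (Finset.mem_range.1 hm).le
    · refine inv_anti₀ (by positivity) ?_
      exact le_self_pow₀ (by linarith [(m.cast_nonneg : (0 : ℝ) ≤ m)]) (by omega)

lemma exists_nestedSum_le (l : List ℕ) :
    ∃ C : ℝ, 0 ≤ C ∧ ∀ n : ℕ, nestedSum l n ≤ C * ((n : ℝ) + 1) ^ (1 / 2 : ℝ) := by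
  obtain ⟨C, hC0, hC⟩ : ∃ C : ℝ, 0 ≤ C ∧
      ∀ x : ℝ, 1 ≤ x → (1 + Real.log x) ^ l.length ≤ C * x ^ (1 / 2 : ℝ) := by
    set k : ℝ := 2 * l.length + 1 with hk
    have hk0 : 0 < k := by positivity
    refine ⟨(1 + k) ^ l.length, by positivity, fun x hx => ?_⟩
    have hx0 : 0 ≤ x := by linarith
    have h1 : Real.log x ≤ k * x ^ k⁻¹ := by
      have := Real.log_le_rpow_div hx0 (inv_pos.2 hk0)
      rwa [div_inv_eq_mul, mul_comm] at this
    have h2 : 1 ≤ x ^ k⁻¹ := Real.one_le_rpow hx (inv_pos.2 hk0).le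
    calc (1 + Real.log x) ^ l.length ≤ ((1 + k) * x ^ k⁻¹) ^ l.length := by
          refine pow_le_pow_left₀ (by linarith [Real.log_nonneg hx]) ?_ _
          linarith
      _ = (1 + k) ^ l.length * x ^ (k⁻¹ * l.length) := by
          rw [mul_pow, Real.rpow_mul hx0, Real.rpow_natCast]
      _ ≤ _ := by
          refine mul_le_mul_of_nonneg_left (Real.rpow_le_rpow_of_exponent_le hx ?_) (by positivity)
          rw [inv_mul_le_iff₀ hk0, hk]
          linarith
  refine ⟨C, hC0, fun n => (nestedSum_le_harmonic_pow l n).trans ?_⟩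
  refine le_trans (pow_le_pow_left₀ ?_ ?_ _)
    (hC ((n : ℝ) + 1) (by linarith [(n.cast_nonneg : (0 : ℝ) ≤ n)]))
  · have : (0 : ℚ) ≤ harmonic n := by
      rw [harmonic]; positivity
    exact_mod_cast this
  · refine (harmonic_le_one_add_log n).trans ?_
    rcases Nat.eq_zero_or_pos n with rfl | hn
    · simp
    · have : (0 : ℝ) < n := by exact_mod_cast hn
      gcongr
      linarith

lemma exists_tendsto_alternating_sum {g : ℕ → ℝ} (h0 : Filter.Tendsto g Filter.atTop (nhds 0))
    (hg : Summable fun n => |g n - g (n + 1)|) :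
    ∃ v, Filter.Tendsto (fun M => ∑ n ∈ Finset.range M, g n * (-1) ^ (n + 1))
      Filter.atTop (nhds v) := by
  have key : ∀ M : ℕ, ∑ n ∈ Finset.range M, g n * (-1) ^ (n + 1) =
      -(1 / 2) * (∑ n ∈ Finset.range M, (-1) ^ n * (g n - g (n + 1)) + g 0 - (-1) ^ M * g M) := by
    intro M
    induction M with
    | zero => simp
    | succ M ih =>
      rw [Finset.sum_range_succ, Finset.sum_range_succ, ih]
      ring
  have hs : Summable fun n => (-1) ^ n * (g n - g (n + 1)) := by
    refine Summable.of_abs ?_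
    simpa [abs_mul] using hg
  have h1 : Filter.Tendsto (fun M : ℕ => (-1) ^ M * g M) Filter.atTop (nhds 0) := by
    rw [tendsto_zero_iff_abs_tendsto_zero] at h0 ⊢
    refine h0.congr fun n => ?_
    simp [abs_mul]
  refine ⟨_, Filter.Tendsto.congr (fun M => (key M).symm)
    (((hs.hasSum.tendsto_sum_nat.add_const (g 0)).sub h1).const_mul _)⟩

lemma exists_tendsto_nestedSum_alternating (t : ℕ) (l : List ℕ) :
    ∃ v : ℝ, Filter.Tendsto (fun M => ∑ m ∈ Finset.range M,
      nestedSum l m / ((m : ℝ) + 1) ^ (t + 1) * (-1) ^ (m + 1)) Filter.atTop (nhds v) := by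
  have hsum : Summable fun n : ℕ => ((n : ℝ) + 1) ^ (-(3 / 2) : ℝ) := by
    have := (summable_nat_add_iff 1).2 (Real.summable_nat_rpow (p := -(3 / 2)) |>.2 (by norm_num))
    simpa using this
  have hpow : ∀ n : ℕ, ((n : ℝ) + 1) ^ (1 / 2 : ℝ) / ((n : ℝ) + 1) ^ 2 =
      ((n : ℝ) + 1) ^ (-(3 / 2) : ℝ) := fun n => by
    rw [← Real.rpow_natCast, ← Real.rpow_sub (by positivity)]
    norm_num
  have hsq : ∀ l, Summable fun n : ℕ => nestedSum l n / ((n : ℝ) + 1) ^ 2 := fun l => by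
    obtain ⟨C, hC0, hC⟩ := exists_nestedSum_le l
    refine Summable.of_nonneg_of_le (fun n => div_nonneg (nestedSum_nonneg l n) (by positivity))
      (fun n => ?_) (hsum.mul_left C)
    rw [← hpow n, ← mul_div_assoc]
    exact div_le_div_of_nonneg_right (hC n) (by positivity)
  have hone : ∀ n : ℕ, (1 : ℝ) ≤ (n : ℝ) + 1 := fun n => by linarith [(n.cast_nonneg : (0 : ℝ) ≤ n)]
  rcases t with _ | t
  · apply exists_tendsto_alternating_sum
    · obtain ⟨C, hC0, hC⟩ := exists_nestedSum_le l
      have hlim : Filter.Tendsto (fun n : ℕ => C * ((n : ℝ) + 1) ^ (-(1 / 2) : ℝ))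
          Filter.atTop (nhds 0) := by
        have := (tendsto_rpow_neg_atTop (y := 1 / 2) (by norm_num)).comp
          (Filter.tendsto_atTop_add_const_right _ (1 : ℝ) tendsto_natCast_atTop_atTop)
        simpa using this.const_mul C
      refine squeeze_zero (fun n => div_nonneg (nestedSum_nonneg l n) (by positivity))
        (fun n => ?_) hlim
      have : ((n : ℝ) + 1) ^ (-(1 / 2) : ℝ) = ((n : ℝ) + 1) ^ (1 / 2 : ℝ) / ((n : ℝ) + 1) := by
        nth_rewrite 3 [← Real.rpow_one ((n : ℝ) + 1)]
        rw [← Real.rpow_sub (by positivity)]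
        norm_num
      rw [this, ← mul_div_assoc, zero_add, pow_one]
      exact div_le_div_of_nonneg_right (hC n) (by positivity)
    · have hdiff : ∀ n, 0 ≤ nestedSum l (n + 1) - nestedSum l n ∧
          nestedSum l (n + 1) - nestedSum l n ≤ nestedSum l.tail n / ((n : ℝ) + 1) := fun n => by
        cases l with
        | nil => simpa [nestedSum_nil] using by positivity
        | cons u l =>
          rw [nestedSum_cons_succ, add_sub_cancel_left]
          refine ⟨div_nonneg (nestedSum_nonneg l n) (by positivity), ?_⟩
          exact div_le_div_of_nonneg_left (nestedSum_nonneg l n) (by positivity)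
            (le_self_pow₀ (hone n) (by omega))
      refine Summable.of_nonneg_of_le (fun n => abs_nonneg _) (fun n => ?_)
        ((hsq l).add (hsq l.tail))
      obtain ⟨h1, h2⟩ := hdiff n
      have h3 := hone n
      have h4 : nestedSum l n / ((n : ℝ) + 1) ^ (0 + 1) -
          nestedSum l (n + 1) / (((n + 1 : ℕ) : ℝ) + 1) ^ (0 + 1) =
          nestedSum l n / (((n : ℝ) + 1) * ((n : ℝ) + 2)) -
          (nestedSum l (n + 1) - nestedSum l n) / ((n : ℝ) + 2) := by
        push_cast
        field_simp
        ring
      have h5 : nestedSum l n / (((n : ℝ) + 1) * ((n : ℝ) + 2)) ≤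
          nestedSum l n / ((n : ℝ) + 1) ^ 2 :=
        div_le_div_of_nonneg_left (nestedSum_nonneg l n) (by positivity) (by nlinarith)
      have h6 : (nestedSum l (n + 1) - nestedSum l n) / ((n : ℝ) + 2) ≤
          nestedSum l.tail n / ((n : ℝ) + 1) ^ 2 := by
        calc _ ≤ (nestedSum l.tail n / ((n : ℝ) + 1)) / ((n : ℝ) + 1) :=
              div_le_div₀ (div_nonneg (nestedSum_nonneg _ n) (by positivity)) h2
                (by positivity) (by linarith)
          _ = _ := by rw [div_div, sq]
      have h7 : 0 ≤ nestedSum l n / (((n : ℝ) + 1) * ((n : ℝ) + 2)) :=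
        div_nonneg (nestedSum_nonneg _ n) (by positivity)
      have h8 : 0 ≤ (nestedSum l (n + 1) - nestedSum l n) / ((n : ℝ) + 2) :=
        div_nonneg h1 (by positivity)
      rw [h4, abs_le]
      constructor <;> linarith
  · refine ⟨_, (Summable.hasSum (Summable.of_abs ?_)).tendsto_sum_nat⟩
    refine Summable.of_nonneg_of_le (fun n => abs_nonneg _) (fun n => ?_) (hsq l)
    rw [abs_mul, abs_pow, abs_neg, abs_one, one_pow, mul_one,
      abs_of_nonneg (div_nonneg (nestedSum_nonneg l n) (by positivity))]
    exact div_le_div_of_nonneg_left (nestedSum_nonneg l n) (by positivity)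
      (pow_le_pow_right₀ (hone n) (by omega))

/-- Sequences bounded in absolute value by `A * (n + 1) ^ k` for some `A` and `k`. -/
def PolynomiallyBounded (c : ℕ → ℝ) : Prop :=
  ∃ (A : ℝ) (k : ℕ), ∀ n : ℕ, |c n| ≤ A * ((n : ℝ) + 1) ^ k

namespace PolynomiallyBounded

lemma mono {c d : ℕ → ℝ} (hc : PolynomiallyBounded c) (h : ∀ n, |d n| ≤ |c n|) :
    PolynomiallyBounded d := by
  obtain ⟨A, k, hA⟩ := hc
  exact ⟨A, k, fun n => (h n).trans (hA n)⟩

lemma succ_mul {c : ℕ → ℝ} (hc : PolynomiallyBounded c) :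
    PolynomiallyBounded fun n => ((n : ℝ) + 1) * c n := by
  obtain ⟨A, k, hA⟩ := hc
  refine ⟨A, k + 1, fun n => ?_⟩
  have : (0 : ℝ) ≤ (n : ℝ) + 1 := by positivity
  rw [abs_mul, abs_of_nonneg this, pow_succ]
  nlinarith [mul_le_mul_of_nonneg_left (hA n) this]

lemma div_pow {c : ℕ → ℝ} (hc : PolynomiallyBounded c) (t : ℕ) :
    PolynomiallyBounded fun n => c n / ((n : ℝ) + 1) ^ t := by
  refine hc.mono fun n => ?_
  have h1 : (1 : ℝ) ≤ ((n : ℝ) + 1) ^ t :=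
    one_le_pow₀ (by linarith [(n.cast_nonneg : (0 : ℝ) ≤ n)])
  rw [abs_div, abs_of_nonneg (zero_le_one.trans h1)]
  exact div_le_self (abs_nonneg _) h1

lemma succ {c : ℕ → ℝ} (hc : PolynomiallyBounded c) :
    PolynomiallyBounded fun n => c (n + 1) := by
  obtain ⟨A, k, hA⟩ := hc
  have hA0 : 0 ≤ A := by simpa using (abs_nonneg _).trans (hA 0)
  refine ⟨A * 2 ^ k, k, fun n => (hA (n + 1)).trans ?_⟩
  rw [mul_assoc, ← mul_pow]
  have : (0 : ℝ) ≤ n := n.cast_nonneg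
  push_cast
  gcongr
  linarith

lemma summable {c : ℕ → ℝ} (hc : PolynomiallyBounded c) {x : ℝ} (hx : |x| < 1) :
    Summable fun n => |c n| * |x| ^ n := by
  obtain ⟨A, k, hA⟩ := hc
  rcases eq_or_ne x 0 with rfl | hx0
  · refine summable_of_ne_finset_zero (s := {0}) fun n hn => ?_
    simp [zero_pow (Finset.notMem_singleton.1 hn)]
  have h := summable_pow_mul_geometric_of_norm_lt_one k (r := |x|) (by simpa using hx)
  have h1 := ((summable_nat_add_iff 1).2 h).mul_left (A / |x|)
  refine Summable.of_nonneg_of_le (fun n => by positivity) (fun n => ?_) h1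
  have hx' : 0 < |x| := abs_pos.2 hx0
  calc |c n| * |x| ^ n ≤ A * ((n : ℝ) + 1) ^ k * |x| ^ n := by gcongr; exact hA n
    _ = _ := by
      push_cast
      rw [pow_succ]
      field_simp

lemma summable_mul_pow {c : ℕ → ℝ} (hc : PolynomiallyBounded c) {x : ℝ} (hx : |x| < 1) :
    Summable fun n => c n * x ^ n := by
  refine Summable.of_abs ?_
  simpa [abs_mul] using hc.summable hx

end PolynomiallyBounded

/-- The power series `∑ cₙ xⁿ⁺¹`. -/
noncomputable def shiftedSeries (c : ℕ → ℝ) (x : ℝ) : ℝ := ∑' n, c n * x ^ (n + 1)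

lemma shiftedSeries_eq_mul (c : ℕ → ℝ) (x : ℝ) :
    shiftedSeries c x = x * ∑' n, c n * x ^ n := by
  rw [shiftedSeries, ← tsum_mul_left]
  exact tsum_congr fun n => by ring

lemma shiftedSeries_zero (c : ℕ → ℝ) : shiftedSeries c 0 = 0 := by
  simp [shiftedSeries_eq_mul]

lemma tsum_eq_add_shiftedSeries {c : ℕ → ℝ} (hc : PolynomiallyBounded c) {x : ℝ}
    (hx : |x| < 1) : ∑' n, c n * x ^ n = c 0 + shiftedSeries (fun n => c (n + 1)) x := by
  rw [(hc.summable_mul_pow hx).tsum_eq_zero_add, pow_zero, mul_one, shiftedSeries]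

lemma hasDerivAt_shiftedSeries {c : ℕ → ℝ} (hc : PolynomiallyBounded c) {x : ℝ}
    (hx : |x| < 1) :
    HasDerivAt (shiftedSeries c) (∑' n : ℕ, ((n : ℝ) + 1) * c n * x ^ n) x := by
  obtain ⟨r, hxr, hr⟩ := exists_between hx
  have hr0 : 0 < r := (abs_nonneg x).trans_lt hxr
  have hu := hc.succ_mul.summable (x := r) (by rwa [abs_of_pos hr0])
  refine hasDerivAt_tsum_of_isPreconnected (g := fun (n : ℕ) y => c n * y ^ (n + 1))
    (g' := fun (n : ℕ) y => ((n : ℝ) + 1) * c n * y ^ n) (t := Metric.ball (0 : ℝ) r) (y₀ := 0)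
    hu Metric.isOpen_ball (convex_ball _ _).isPreconnected ?_ ?_ (by simpa using hr0) ?_
    (by simpa using hxr)
  · intro n y _
    refine ((hasDerivAt_pow (n + 1) y).const_mul (c n)).congr_deriv ?_
    push_cast [add_tsub_cancel_right]
    ring
  · intro n y hy
    rw [mem_ball_zero_iff, Real.norm_eq_abs] at hy
    rw [Real.norm_eq_abs, abs_mul, abs_pow, abs_of_pos hr0]
    gcongr
  · simp

lemma hasDerivAt_shiftedSeries_div {c : ℕ → ℝ} (hc : PolynomiallyBounded c) {x : ℝ}
    (hx : |x| < 1) (t : ℕ) :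
    HasDerivAt (shiftedSeries fun n => c n / ((n : ℝ) + 1) ^ (t + 1))
      (∑' n, c n / ((n : ℝ) + 1) ^ t * x ^ n) x := by
  refine (hasDerivAt_shiftedSeries (hc.div_pow (t + 1)) hx).congr_deriv ?_
  refine tsum_congr fun n => ?_
  have : (n : ℝ) + 1 ≠ 0 := by positivity
  rw [pow_succ]
  field_simp

lemma polynomiallyBounded_nestedSum (l : List ℕ) : PolynomiallyBounded (nestedSum l) := by
  obtain ⟨C, hC0, hC⟩ := exists_nestedSum_le l
  refine ⟨C, 1, fun n => ?_⟩
  rw [abs_of_nonneg (nestedSum_nonneg l n), pow_one]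
  refine (hC n).trans (mul_le_mul_of_nonneg_left ?_ hC0)
  exact Real.rpow_le_self_of_one_le (by linarith [(n.cast_nonneg : (0 : ℝ) ≤ n)]) (by norm_num)

/-- The one-variable multiple polylogarithm
`∑_{n > n₁ > ⋯ > n_k ≥ 1} xⁿ / (n ^ (t + 1) * ∏ᵢ nᵢ ^ (lᵢ + 1))`. -/
noncomputable def multiPolylog (t : ℕ) (l : List ℕ) : ℝ → ℝ :=
  shiftedSeries fun n => nestedSum l n / ((n : ℝ) + 1) ^ (t + 1)

lemma multiPolylog_zero (t : ℕ) (l : List ℕ) : multiPolylog t l 0 = 0 := shiftedSeries_zero _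

lemma hasDerivAt_multiPolylog_succ (t : ℕ) (l : List ℕ) {x : ℝ} (hx : |x| < 1) (hx0 : x ≠ 0) :
    HasDerivAt (multiPolylog (t + 1) l) (multiPolylog t l x / x) x := by
  refine (hasDerivAt_shiftedSeries_div (polynomiallyBounded_nestedSum l) hx (t + 1)).congr_deriv ?_
  rw [multiPolylog, shiftedSeries_eq_mul, mul_div_cancel_left₀ _ hx0]

lemma hasDerivAt_multiPolylog_zero_nil {x : ℝ} (hx : |x| < 1) :
    HasDerivAt (multiPolylog 0 []) (1 / (1 - x)) x := by
  refine (hasDerivAt_shiftedSeries_div (polynomiallyBounded_nestedSum []) hx 0).congr_deriv ?_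
  simp [nestedSum_nil, tsum_geometric_of_abs_lt_one hx]

lemma hasDerivAt_multiPolylog_zero_cons (t : ℕ) (l : List ℕ) {x : ℝ} (hx : |x| < 1) :
    HasDerivAt (multiPolylog 0 (t :: l)) (multiPolylog t l x / (1 - x)) x := by
  have hb := polynomiallyBounded_nestedSum (t :: l)
  refine (hasDerivAt_shiftedSeries_div hb hx 0).congr_deriv ?_
  have h1 : 1 - x ≠ 0 := by linarith [(abs_lt.1 hx).2]
  simp only [pow_zero, div_one]
  rw [eq_div_iff h1]
  have h2 := tsum_eq_add_shiftedSeries hb hx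
  have h3 : shiftedSeries (fun n => nestedSum (t :: l) (n + 1)) x =
      shiftedSeries (nestedSum (t :: l)) x + multiPolylog t l x := by
    simp only [multiPolylog, shiftedSeries_eq_mul]
    rw [← mul_add, ← (hb.summable_mul_pow hx).tsum_add
      (((polynomiallyBounded_nestedSum l).div_pow (t + 1)).summable_mul_pow hx)]
    congr 1
    refine tsum_congr fun n => ?_
    rw [nestedSum_cons_succ, add_mul]
  rw [nestedSum_cons_zero, h3, shiftedSeries_eq_mul (nestedSum (t :: l))] at h2
  linarith

lemma continuousAt_multiPolylog (t : ℕ) (l : List ℕ) {x : ℝ} (hx : |x| < 1) :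
    ContinuousAt (multiPolylog t l) x :=
  (hasDerivAt_shiftedSeries_div (polynomiallyBounded_nestedSum l) hx t).continuousAt

lemma exists_tendsto_multiPolylog (t : ℕ) (l : List ℕ) :
    ∃ v : ℝ, (v : ℂ) ∈ CMZV 2 (t + 1 + (l.sum + l.length)) ∧
      Filter.Tendsto (fun z => multiPolylog t l (-z)) (nhdsWithin 1 (Set.Iio 1)) (nhds v) := by
  obtain ⟨v, hv⟩ := exists_tendsto_nestedSum_alternating t l
  refine ⟨v, Submodule.subset_span ⟨l.length + 1, Nat.succ_pos _,
    Fin.cons (t + 1) fun i => l.get i + 1, Fin.cons (-1) fun _ => 1, ?_, ?_, ?_, ?_, ?_⟩, ?_⟩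
  · intro i
    refine Fin.cases ?_ (fun i => ?_) i <;> simp
  · rw [Fin.sum_univ_succ]
    simp only [Fin.cons_zero, Fin.cons_succ, Finset.sum_add_distrib]
    simp
  · intro i
    refine Fin.cases ?_ (fun i => ?_) i <;> simp
  · rintro ⟨-, h⟩
    have h' : (-1 : ℂ) = 1 := h
    norm_num at h'
  · refine Filter.Tendsto.congr (fun M => (multiplePartialSum_cons_neg_one t l M).symm) ?_
    exact (Complex.continuous_ofReal.tendsto v).comp hv
  · have h1 := Real.tendsto_tsum_powerSeries_nhdsWithin_lt hv
    have h2 : Filter.Tendsto (fun z : ℝ => z) (nhdsWithin 1 (Set.Iio 1)) (nhds 1) :=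
      Filter.tendsto_id.mono_left nhdsWithin_le_nhds
    have h3 := h2.mul h1
    rw [one_mul] at h3
    refine h3.congr fun z => ?_
    rw [multiPolylog, shiftedSeries, ← tsum_mul_left]
    refine tsum_congr fun n => ?_
    rw [neg_pow z (n + 1)]
    ring

/-- The `ℚ`-span of the functions `z ↦ Li(-z)` over one-variable multiple polylogarithms `Li`
of weight `w`. -/
noncomputable def polylogSpan (w : ℕ) : Submodule ℚ (ℝ → ℝ) :=
  Submodule.span ℚ {f | ∃ (t : ℕ) (l : List ℕ), t + 1 + (l.sum + l.length) = w ∧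
    f = fun z => multiPolylog t l (-z)}

lemma exists_tendsto_of_mem_polylogSpan {w : ℕ} {f : ℝ → ℝ} (hf : f ∈ polylogSpan w) :
    ∃ v : ℝ, (v : ℂ) ∈ CMZV 2 w ∧
      Filter.Tendsto f (nhdsWithin 1 (Set.Iio 1)) (nhds v) := by
  induction hf using Submodule.span_induction with
  | mem f hf =>
    obtain ⟨t, l, rfl, rfl⟩ := hf
    exact exists_tendsto_multiPolylog t l
  | zero => exact ⟨0, by simp, tendsto_const_nhds⟩
  | add f g _ _ hf hg =>
    obtain ⟨v, hv, hfv⟩ := hf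
    obtain ⟨u, hu, hgu⟩ := hg
    exact ⟨v + u, by simpa using add_mem hv hu, hfv.add hgu⟩
  | smul q f _ hf =>
    obtain ⟨v, hv, hfv⟩ := hf
    refine ⟨q • v, ?_, hfv.const_smul q⟩
    have := (CMZV 2 w).smul_mem q hv
    rw [Rat.smul_def] at this ⊢
    exact_mod_cast this

/-- Evaluation at the endpoint `1` of a function agreeing with a multiple polylogarithm. -/
lemma mem_CMZV_of_eqOn {w : ℕ} {f h : ℝ → ℝ} (hf : f ∈ polylogSpan w)
    (hfh : Set.EqOn h f (Set.Ioo 0 1)) (hh : ContinuousAt h 1) : (h 1 : ℂ) ∈ CMZV 2 w := by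
  obtain ⟨v, hv, hfv⟩ := exists_tendsto_of_mem_polylogSpan hf
  have h1 : Filter.Tendsto h (nhdsWithin 1 (Set.Iio 1)) (nhds (h 1)) :=
    hh.tendsto.mono_left nhdsWithin_le_nhds
  have h2 : Filter.Tendsto h (nhdsWithin 1 (Set.Iio 1)) (nhds v) := by
    refine hfv.congr' ?_
    filter_upwards [Ioo_mem_nhdsLT (zero_lt_one' ℝ)] with z hz
    exact (hfh hz).symm
  rwa [tendsto_nhds_unique h1 h2]

lemma exists_primitive_of_mem_polylogSpan {w : ℕ} {f : ℝ → ℝ} (hf : f ∈ polylogSpan w) :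
    ∃ g ∈ polylogSpan (w + 1), g 0 = 0 ∧ ContinuousOn g (Set.Ico 0 1) ∧
      ∀ z ∈ Set.Ioo (0 : ℝ) 1, HasDerivAt g (f z * (2 / z - 1 / (1 + z))) z := by
  induction hf using Submodule.span_induction with
  | mem f hf =>
    obtain ⟨t, l, rfl, rfl⟩ := hf
    have hneg : ∀ z ∈ Set.Ico (0 : ℝ) 1, |(-z)| < 1 := fun z hz => by
      rw [abs_neg, abs_of_nonneg hz.1]; exact hz.2
    refine ⟨(2 : ℚ) • (fun z => multiPolylog (t + 1) l (-z)) +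
      fun z => multiPolylog 0 (t :: l) (-z), ?_, ?_, ?_, ?_⟩
    · refine add_mem (Submodule.smul_mem _ _ (Submodule.subset_span ⟨_, _, ?_, rfl⟩))
        (Submodule.subset_span ⟨_, _, ?_, rfl⟩)
      · omega
      · simp only [List.sum_cons, List.length_cons]; omega
    · simp [multiPolylog_zero]
    · have hc : ∀ u m, ContinuousOn (fun z => multiPolylog u m (-z)) (Set.Ico 0 1) :=
        fun u m z hz => ((continuousAt_multiPolylog u m (hneg z hz)).comp
          continuous_neg.continuousAt).continuousWithinAt
      exact ((hc _ _).const_smul (2 : ℚ)).add (hc _ _)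
    · intro z hz
      have hz' := hneg z ⟨hz.1.le, hz.2⟩
      have h1 := ((hasDerivAt_multiPolylog_succ t l hz' (neg_ne_zero.2 hz.1.ne')).comp z
        (hasDerivAt_neg z)).const_smul (2 : ℚ)
      have h2 := (hasDerivAt_multiPolylog_zero_cons t l hz').comp z (hasDerivAt_neg z)
      refine (h1.add h2).congr_deriv ?_
      have := hz.1.ne'
      have h3 : 1 + z ≠ 0 := by linarith [hz.1]
      rw [Rat.smul_def, sub_neg_eq_add]
      push_cast
      field_simp
      ring
  | zero => exact ⟨0, zero_mem _, rfl, continuousOn_const, fun z _ => by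
      simp [hasDerivAt_zero]⟩
  | add f₁ f₂ _ _ hf₁ hf₂ =>
    obtain ⟨g₁, hg₁, h0₁, hc₁, hd₁⟩ := hf₁
    obtain ⟨g₂, hg₂, h0₂, hc₂, hd₂⟩ := hf₂
    refine ⟨g₁ + g₂, add_mem hg₁ hg₂, by simp [h0₁, h0₂], hc₁.add hc₂, fun z hz => ?_⟩
    refine ((hd₁ z hz).add (hd₂ z hz)).congr_deriv ?_
    rw [Pi.add_apply]
    ring
  | smul q f _ hf =>
    obtain ⟨g, hg, h0, hc, hd⟩ := hf
    refine ⟨q • g, Submodule.smul_mem _ _ hg, by simp [h0], hc.const_smul q, fun z hz => ?_⟩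
    refine ((hd z hz).const_smul q).congr_deriv ?_
    rw [Pi.smul_apply, smul_mul_assoc]

lemma eqOn_of_hasDerivAt_eq {f g f' : ℝ → ℝ} (hf : ContinuousOn f (Set.Ico 0 1))
    (hg : ContinuousOn g (Set.Ico 0 1)) (h0 : f 0 = g 0)
    (hf' : ∀ z ∈ Set.Ioo (0 : ℝ) 1, HasDerivAt f (f' z) z)
    (hg' : ∀ z ∈ Set.Ioo (0 : ℝ) 1, HasDerivAt g (f' z) z) : Set.EqOn f g (Set.Ioo 0 1) := by
  intro b hb
  have hsub : Set.Icc 0 b ⊆ Set.Ico (0 : ℝ) 1 := fun z hz => ⟨hz.1, hz.2.trans_lt hb.2⟩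
  obtain ⟨c, -, hc⟩ := exists_hasDerivAt_eq_slope (f - g) (fun _ => 0) hb.1
    ((hf.sub hg).mono hsub) fun z hz => by
      have hz' : z ∈ Set.Ioo (0 : ℝ) 1 := ⟨hz.1, hz.2.trans hb.2⟩
      simpa using (hf' z hz').sub (hg' z hz')
  rw [eq_comm, div_eq_zero_iff] at hc
  simp only [Pi.sub_apply, h0, sub_self, sub_zero] at hc
  rcases hc with hc | hc
  · linarith
  · exact absurd hc hb.1.ne'

/-- The coefficients `(-1)ⁿ⁺¹ / ((n + 1) * C(2n + 2, n + 1))`. -/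
noncomputable def centralBinomCoeff (n : ℕ) : ℝ :=
  (-1) ^ (n + 1) / (((n : ℝ) + 1) * (Nat.centralBinom (n + 1) : ℝ))

lemma centralBinomCoeff_zero : centralBinomCoeff 0 = -(1 / 2) := by
  norm_num [centralBinomCoeff, Nat.centralBinom]

lemma centralBinomCoeff_succ (n : ℕ) :
    4 * (((n : ℝ) + 2) * centralBinomCoeff (n + 1)) + ((n : ℝ) + 1) * centralBinomCoeff n =
      2 * centralBinomCoeff (n + 1) := by
  have h : ((n : ℝ) + 2) * (Nat.centralBinom (n + 2) : ℝ) =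
      2 * (2 * n + 3) * (Nat.centralBinom (n + 1) : ℝ) := by
    have := Nat.succ_mul_centralBinom_succ (n + 1)
    have h' : (((n + 1 + 1) * (n + 1 + 1).centralBinom : ℕ) : ℝ) =
        ((2 * (2 * (n + 1) + 1) * (n + 1).centralBinom : ℕ) : ℝ) := by rw [this]
    push_cast at h'
    linear_combination h'
  have h1 : (Nat.centralBinom (n + 1) : ℝ) ≠ 0 := by
    exact_mod_cast (Nat.centralBinom_pos _).ne'
  have h3 : (2 * (n : ℝ) + 3) ≠ 0 := by positivity
  have e1 : centralBinomCoeff (n + 1) =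
      (-1) ^ n / (2 * (2 * n + 3) * (Nat.centralBinom (n + 1) : ℝ)) := by
    rw [← h, centralBinomCoeff]
    push_cast
    ring_nf
  rw [e1, centralBinomCoeff]
  have h4 : (n : ℝ) + 1 ≠ 0 := by positivity
  field_simp
  ring

lemma polynomiallyBounded_centralBinomCoeff : PolynomiallyBounded centralBinomCoeff := by
  refine ⟨1, 0, fun n => ?_⟩
  have h1 : (1 : ℝ) ≤ Nat.centralBinom (n + 1) := by exact_mod_cast Nat.centralBinom_pos _
  have h2 : (1 : ℝ) ≤ (n : ℝ) + 1 := by linarith [(n.cast_nonneg : (0 : ℝ) ≤ n)]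
  rw [centralBinomCoeff, abs_div, abs_pow, abs_neg, abs_one, one_pow, pow_zero, mul_one,
    abs_of_nonneg (by positivity)]
  exact div_le_one_of_le₀ (one_le_mul_of_one_le_of_one_le h2 h1) (by positivity)

/-- The power series `∑ (-1)ⁿ⁺¹ yⁿ / ((n + 1) * C(2n + 2, n + 1))`. -/
noncomputable def centralBinomSeries (y : ℝ) : ℝ := ∑' n, centralBinomCoeff n * y ^ n

lemma exists_hasDerivAt_centralBinomSeries {y : ℝ} (hy : |y| < 1) :
    ∃ e, HasDerivAt centralBinomSeries e y ∧
      (4 + y) * (centralBinomSeries y + y * e) = 2 * centralBinomSeries y - 1 := by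
  have hd := polynomiallyBounded_centralBinomCoeff
  set d := centralBinomCoeff with hd_def
  have hb := hd.succ_mul
  refine ⟨∑' n : ℕ, ((n : ℝ) + 1) * d (n + 1) * y ^ n, ?_, ?_⟩
  · refine ((hasDerivAt_shiftedSeries hd.succ hy).const_add (d 0)).congr_of_eventuallyEq ?_
    have : ∀ᶠ x : ℝ in nhds y, |x| < 1 :=
      continuous_abs.continuousAt.eventually_lt continuousAt_const hy
    filter_upwards [this] with x hx
    exact tsum_eq_add_shiftedSeries hd hx
  · have hT : centralBinomSeries y + y * ∑' n : ℕ, ((n : ℝ) + 1) * d (n + 1) * y ^ n =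
        ∑' n : ℕ, ((n : ℝ) + 1) * d n * y ^ n := by
      have hy1 := hd.succ.summable_mul_pow hy
      have hy2 := hd.succ.succ_mul.summable_mul_pow hy
      rw [centralBinomSeries, ← hd_def, tsum_eq_add_shiftedSeries hd hy,
        tsum_eq_add_shiftedSeries hb hy, shiftedSeries_eq_mul, shiftedSeries_eq_mul, add_assoc,
        ← mul_add, ← hy1.tsum_add hy2]
      simp only [Nat.cast_zero, zero_add, one_mul]
      congr 2
      refine tsum_congr fun n => ?_
      push_cast
      ring
    have hsum : 4 * ∑' n : ℕ, ((n + 1 : ℕ) + 1 : ℝ) * d (n + 1) * y ^ n +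
        ∑' n : ℕ, ((n : ℝ) + 1) * d n * y ^ n = 2 * ∑' n, d (n + 1) * y ^ n := by
      rw [← tsum_mul_left, ← tsum_mul_left,
        ← (((hb.succ).summable_mul_pow hy).mul_left 4).tsum_add (hb.summable_mul_pow hy)]
      refine tsum_congr fun n => ?_
      have := centralBinomCoeff_succ n
      push_cast
      linear_combination y ^ n * this
    have h1 : centralBinomSeries y = d 0 + y * ∑' n, d (n + 1) * y ^ n := by
      rw [← shiftedSeries_eq_mul]
      exact tsum_eq_add_shiftedSeries hd hy
    have h2 := tsum_eq_add_shiftedSeries hb hy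
    rw [shiftedSeries_eq_mul] at h2
    have h0 : d 0 = -(1 / 2) := centralBinomCoeff_zero
    simp only [Nat.cast_zero, zero_add, one_mul] at h2
    rw [hT, h1]
    linear_combination 4 * h2 + y * hsum + 2 * h0

lemma abs_sq_div_one_add_lt_one {z : ℝ} (hz : z ∈ Set.Icc (0 : ℝ) 1) : |z ^ 2 / (1 + z)| < 1 := by
  obtain ⟨h0, h1⟩ := hz
  rw [abs_of_nonneg (by positivity), div_lt_one (by positivity)]
  nlinarith

lemma hasDerivAt_sq_div_one_add {z : ℝ} (hz : 1 + z ≠ 0) :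
    HasDerivAt (fun z : ℝ => z ^ 2 / (1 + z)) (z * (z + 2) / (1 + z) ^ 2) z := by
  refine ((hasDerivAt_pow 2 z).div ((hasDerivAt_id z).const_add 1) hz).congr_deriv ?_
  simp
  field_simp
  ring

lemma centralBinomSeries_eqOn_multiPolylog :
    Set.EqOn (fun z => z * (z + 2) / (1 + z) * centralBinomSeries (z ^ 2 / (1 + z)))
      (fun z => multiPolylog 0 [] (-z)) (Set.Ioo 0 1) := by
  have hneg : ∀ z ∈ Set.Ico (0 : ℝ) 1, |(-z)| < 1 := fun z hz => by
    rw [abs_neg, abs_of_nonneg hz.1]; exact hz.2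
  have hderiv₁ : ∀ z ∈ Set.Ico (0 : ℝ) 1, HasDerivAt
      (fun z => z * (z + 2) / (1 + z) * centralBinomSeries (z ^ 2 / (1 + z)))
      (-(1 / (1 + z))) z := fun z hz => by
    have hz1 : 1 + z ≠ 0 := by linarith [hz.1]
    obtain ⟨e, he, hode⟩ := exists_hasDerivAt_centralBinomSeries
      (abs_sq_div_one_add_lt_one ⟨hz.1, hz.2.le⟩)
    have hu : HasDerivAt (fun z : ℝ => z * (z + 2) / (1 + z))
        ((z ^ 2 + 2 * z + 2) / (1 + z) ^ 2) z := by
      refine (((hasDerivAt_id z).mul ((hasDerivAt_id z).add_const 2)).div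
        ((hasDerivAt_id z).const_add 1) hz1).congr_deriv ?_
      simp
      field_simp
      ring
    refine (hu.mul (he.comp z (hasDerivAt_sq_div_one_add hz1))).congr_deriv ?_
    simp only [Function.comp]
    generalize centralBinomSeries (z ^ 2 / (1 + z)) = E at hode
    field_simp at hode ⊢
    linear_combination hode
  have hderiv₂ : ∀ z ∈ Set.Ico (0 : ℝ) 1, HasDerivAt (fun z => multiPolylog 0 [] (-z))
      (-(1 / (1 + z))) z := fun z hz => by
    refine ((hasDerivAt_multiPolylog_zero_nil (hneg z hz)).comp z (hasDerivAt_neg z)).congr_deriv ?_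
    rw [sub_neg_eq_add]
    ring
  exact eqOn_of_hasDerivAt_eq (fun z hz => (hderiv₁ z hz).continuousAt.continuousWithinAt)
    (fun z hz => (hderiv₂ z hz).continuousAt.continuousWithinAt) (by simp [multiPolylog_zero])
    (fun z hz => hderiv₁ z ⟨hz.1.le, hz.2⟩) (fun z hz => hderiv₂ z ⟨hz.1.le, hz.2⟩)

/-- The series `∑_{n ≥ 1} (-y)ⁿ / (n ^ (k + 1) * C(2n, n))`. -/
noncomputable def inverseBinomPolylog (k : ℕ) : ℝ → ℝ :=
  shiftedSeries fun n => centralBinomCoeff n / ((n : ℝ) + 1) ^ k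

lemma hasDerivAt_inverseBinomPolylog_succ (k : ℕ) {y : ℝ} (hy : |y| < 1) :
    HasDerivAt (inverseBinomPolylog (k + 1))
      (∑' n : ℕ, centralBinomCoeff n / ((n : ℝ) + 1) ^ k * y ^ n) y :=
  hasDerivAt_shiftedSeries_div polynomiallyBounded_centralBinomCoeff hy k

lemma continuousAt_inverseBinomPolylog_comp (k : ℕ) {z : ℝ} (hz : z ∈ Set.Icc (0 : ℝ) 1) :
    ContinuousAt (fun z : ℝ => inverseBinomPolylog k (z ^ 2 / (1 + z))) z := by
  have h1 : ContinuousAt (inverseBinomPolylog k) (z ^ 2 / (1 + z)) :=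
    (hasDerivAt_shiftedSeries (polynomiallyBounded_centralBinomCoeff.div_pow k)
      (abs_sq_div_one_add_lt_one hz)).continuousAt
  have h2 := (hasDerivAt_sq_div_one_add (z := z) (by linarith [hz.1])).continuousAt
  exact ContinuousAt.comp (f := fun z : ℝ => z ^ 2 / (1 + z)) h1 h2

lemma exists_mem_polylogSpan_eqOn (k : ℕ) :
    ∃ f ∈ polylogSpan (k + 2),
      Set.EqOn (fun z => inverseBinomPolylog (k + 1) (z ^ 2 / (1 + z))) f (Set.Ioo 0 1) := by
  have hcont : ∀ k, ContinuousOn (fun z : ℝ => inverseBinomPolylog k (z ^ 2 / (1 + z)))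
      (Set.Ico 0 1) := fun k z hz =>
    (continuousAt_inverseBinomPolylog_comp k ⟨hz.1, hz.2.le⟩).continuousWithinAt
  have hderiv : ∀ k, ∀ z ∈ Set.Ioo (0 : ℝ) 1, HasDerivAt
      (fun z : ℝ => inverseBinomPolylog (k + 1) (z ^ 2 / (1 + z)))
      ((∑' n : ℕ, centralBinomCoeff n / ((n : ℝ) + 1) ^ k * (z ^ 2 / (1 + z)) ^ n) *
        (z * (z + 2) / (1 + z) ^ 2)) z := fun k z hz =>
    (hasDerivAt_inverseBinomPolylog_succ k (abs_sq_div_one_add_lt_one ⟨hz.1.le, hz.2.le⟩)).comp z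
      (hasDerivAt_sq_div_one_add (by linarith [hz.1]))
  induction k with
  | zero =>
    have hneg : ∀ z ∈ Set.Ico (0 : ℝ) 1, |(-z)| < 1 := fun z hz => by
      rw [abs_neg, abs_of_nonneg hz.1]; exact hz.2
    refine ⟨-fun z => multiPolylog 0 [0] (-z),
      neg_mem (Submodule.subset_span ⟨0, [0], by simp, rfl⟩), ?_⟩
    refine eqOn_of_hasDerivAt_eq (hcont 1) (ContinuousOn.neg fun z hz => ?_) ?_ (hderiv 0) ?_
    · exact ((continuousAt_multiPolylog 0 [0] (hneg z hz)).comp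
        continuous_neg.continuousAt).continuousWithinAt
    · simp [inverseBinomPolylog, shiftedSeries_zero, multiPolylog_zero]
    · intro z hz
      have h := ((hasDerivAt_multiPolylog_zero_cons 0 [] (hneg z ⟨hz.1.le, hz.2⟩)).comp z
        (hasDerivAt_neg z)).neg
      refine h.congr_deriv ?_
      have h1 := centralBinomSeries_eqOn_multiPolylog hz
      have hz1 : 1 + z ≠ 0 := by linarith [hz.1]
      simp only [centralBinomSeries] at h1
      simp only [pow_zero, div_one]
      rw [← h1, sub_neg_eq_add]
      field_simp
  | succ k ih =>
    obtain ⟨f, hf, hfe⟩ := ih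
    obtain ⟨g, hg, hg0, hgc, hgd⟩ := exists_primitive_of_mem_polylogSpan hf
    refine ⟨g, hg, eqOn_of_hasDerivAt_eq (hcont _) hgc ?_ (hderiv _) fun z hz => ?_⟩
    · simp [hg0, inverseBinomPolylog, shiftedSeries_zero]
    · refine (hgd z hz).congr_deriv ?_
      rw [← hfe hz]
      have hz0 := hz.1.ne'
      have hz1 : 1 + z ≠ 0 := by linarith [hz.1]
      simp only [inverseBinomPolylog]
      rw [shiftedSeries_eq_mul]
      field_simp
      ring

lemma inverseBinomPolylog_half_mem_CMZV (k : ℕ) :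
    (inverseBinomPolylog k (1 / 2) : ℂ) ∈ CMZV 2 (k + 1) := by
  have h1 : (1 : ℝ) ∈ Set.Icc (0 : ℝ) 1 := by simp
  rcases k with _ | k
  · have hmem : (fun z => multiPolylog 0 [] (-z)) ∈ polylogSpan 1 :=
      Submodule.subset_span ⟨0, [], by simp, rfl⟩
    have hcont : ContinuousAt
        (fun z => z * (z + 2) / (1 + z) * centralBinomSeries (z ^ 2 / (1 + z))) (1 : ℝ) := by
      obtain ⟨e, he, -⟩ := exists_hasDerivAt_centralBinomSeries (abs_sq_div_one_add_lt_one h1)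
      refine ContinuousAt.mul ?_ (ContinuousAt.comp (f := fun z : ℝ => z ^ 2 / (1 + z))
        he.continuousAt (hasDerivAt_sq_div_one_add (by norm_num)).continuousAt)
      exact ContinuousAt.div (by fun_prop) (by fun_prop) (by norm_num)
    have h := mem_CMZV_of_eqOn hmem centralBinomSeries_eqOn_multiPolylog hcont
    have h' := (CMZV 2 1).smul_mem (1 / 3 : ℚ) h
    rw [Rat.smul_def] at h'
    have e : inverseBinomPolylog 0 (1 / 2) = 1 / 2 * centralBinomSeries (1 / 2) := by
      rw [inverseBinomPolylog, shiftedSeries_eq_mul, centralBinomSeries]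
      simp
    rw [e]
    convert h' using 1
    norm_num
    ring
  · obtain ⟨f, hf, hfe⟩ := exists_mem_polylogSpan_eqOn k
    have h := mem_CMZV_of_eqOn hf hfe (continuousAt_inverseBinomPolylog_comp (k + 1) h1)
    norm_num at h
    norm_num
    exact h

/-- For every positive integer `s`, the convergent series
`∑_{n=1}^∞ (-1)^n / (n^s · 2^n · C(2n,n))` belongs to `CMZV²_s`. -/
theorem statement7 (s : ℕ) (hs : 0 < s) :
    Summable (fun n : ℕ =>
      (-1 : ℝ) ^ (n + 1) / (((n + 1 : ℕ) : ℝ) ^ s * 2 ^ (n + 1)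
        * (Nat.choose (2 * (n + 1)) (n + 1) : ℝ))) ∧
    ((↑(∑' n : ℕ, (-1 : ℝ) ^ (n + 1) / (((n + 1 : ℕ) : ℝ) ^ s * 2 ^ (n + 1)
        * (Nat.choose (2 * (n + 1)) (n + 1) : ℝ))) : ℂ) ∈ CMZV 2 s) := by
  obtain ⟨k, rfl⟩ : ∃ k, s = k + 1 := ⟨s - 1, by omega⟩
  have hterm : ∀ n : ℕ, (-1 : ℝ) ^ (n + 1) / (((n + 1 : ℕ) : ℝ) ^ (k + 1) * 2 ^ (n + 1)
        * (Nat.choose (2 * (n + 1)) (n + 1) : ℝ)) =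
      centralBinomCoeff n / ((n : ℝ) + 1) ^ k * (1 / 2) ^ (n + 1) := fun n => by
    have h1 : (Nat.centralBinom (n + 1) : ℝ) ≠ 0 := by
      exact_mod_cast (Nat.centralBinom_pos _).ne'
    have h2 : (n : ℝ) + 1 ≠ 0 := by positivity
    rw [← Nat.centralBinom_eq_two_mul_choose, centralBinomCoeff, one_div, inv_pow]
    push_cast
    field_simp
    ring
  simp only [hterm]
  refine ⟨?_, inverseBinomPolylog_half_mem_CMZV k⟩
  have hb := (polynomiallyBounded_centralBinomCoeff.div_pow k).summable_mul_pow
    (x := 1 / 2) (by rw [abs_of_pos] <;> norm_num)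
  refine (hb.mul_right (1 / 2)).congr fun n => ?_
  ring
end

section
/- Let N be a positive integer, k ≥ 1, let s₁,…,s_k be positive integers, and let a₁,…,a_k be N-th roots of unity. For M ≥ 0 define H_M = ∑_{M ≥ n₁ > ⋯ > n_k ≥ 1} a₁^{n₁}⋯a_k^{n_k}/(n₁^{s₁}⋯n_k^{s_k}). Then there exist a polynomial P ∈ ℂ[T] with zero constant term and a constant c ∈ CMZV^N_{s₁+⋯+s_k} such that H_M = P(log M + γ) + c + o(1) as M → ∞, where γ is the Euler–Mascheroni constant. -/
open scoped BigOperators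

open Filter Asymptotics Polynomial

/-! ### Growth classes of sequences -/

/-- Sequences that are `O(M ^ ε)` for every `ε > 0`. -/
def IsSubpolynomial (f : ℕ → ℂ) : Prop :=
  ∀ ε : ℝ, 0 < ε → f =O[atTop] fun M : ℕ => (M : ℝ) ^ ε

/-- Sequences that are `O(M ^ (-δ))` for some `δ > 0`. -/
def IsPowerDecaying (f : ℕ → ℂ) : Prop :=
  ∃ δ : ℝ, 0 < δ ∧ f =O[atTop] fun M : ℕ => (M : ℝ) ^ (-δ)

lemma rpow_natCast_isBigO_of_le {p q : ℝ} (h : p ≤ q) :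
    (fun M : ℕ => (M : ℝ) ^ p) =O[atTop] fun M : ℕ => (M : ℝ) ^ q := by
  refine IsBigO.of_bound 1 ?_
  filter_upwards [eventually_ge_atTop 1] with M hM
  have hM' : (1 : ℝ) ≤ M := by exact_mod_cast hM
  rw [Real.norm_of_nonneg (by positivity), Real.norm_of_nonneg (by positivity), one_mul]
  exact Real.rpow_le_rpow_of_exponent_le hM' h

lemma isBigO_rpow_mul {f g : ℕ → ℂ} {p q r : ℝ}
    (hf : f =O[atTop] fun M : ℕ => (M : ℝ) ^ p) (hg : g =O[atTop] fun M : ℕ => (M : ℝ) ^ q)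
    (h : p + q ≤ r) : (fun M => f M * g M) =O[atTop] fun M : ℕ => (M : ℝ) ^ r := by
  refine ((hf.mul hg).congr' EventuallyEq.rfl ?_).trans (rpow_natCast_isBigO_of_le h)
  filter_upwards [eventually_ge_atTop 1] with M hM
  have hM' : (0 : ℝ) < M := by exact_mod_cast hM
  rw [Real.rpow_add hM']

namespace IsSubpolynomial

lemma const (c : ℂ) : IsSubpolynomial fun _ => c := by
  intro ε hε
  have h : (fun _ : ℕ => c) =O[atTop] fun M : ℕ => (M : ℝ) ^ (0 : ℝ) := by
    simpa using isBigO_const_const c (one_ne_zero (α := ℝ)) atTop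
  exact h.trans (rpow_natCast_isBigO_of_le hε.le)

lemma add {f g : ℕ → ℂ} (hf : IsSubpolynomial f) (hg : IsSubpolynomial g) :
    IsSubpolynomial fun M => f M + g M :=
  fun ε hε => (hf ε hε).add (hg ε hε)

lemma mul {f g : ℕ → ℂ} (hf : IsSubpolynomial f) (hg : IsSubpolynomial g) :
    IsSubpolynomial fun M => f M * g M :=
  fun ε hε => isBigO_rpow_mul (hf (ε / 2) (by linarith)) (hg (ε / 2) (by linarith)) (by linarith)

lemma pow {f : ℕ → ℂ} (hf : IsSubpolynomial f) (d : ℕ) : IsSubpolynomial fun M => f M ^ d := by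
  induction d with
  | zero => simpa using const 1
  | succ d ih => simpa [pow_succ] using ih.mul hf

lemma of_norm_le {f g : ℕ → ℂ} (hg : IsSubpolynomial g) (h : ∀ M, ‖f M‖ ≤ ‖g M‖) :
    IsSubpolynomial f :=
  fun ε hε => (IsBigO.of_bound 1 (.of_forall fun M => by simpa using h M)).trans (hg ε hε)

lemma log : IsSubpolynomial fun M => ((Real.log M : ℝ) : ℂ) := by
  intro ε hε
  have h := (isLittleO_log_rpow_atTop hε).isBigO.comp_tendsto
    (tendsto_natCast_atTop_atTop (R := ℝ))
  exact (IsBigO.of_bound 1 (.of_forall fun M => by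
    rw [Complex.norm_real, one_mul]; rfl)).trans h

lemma polynomial_eval {f : ℕ → ℂ} (hf : IsSubpolynomial f) (P : ℂ[X]) :
    IsSubpolynomial fun M => P.eval (f M) := by
  induction P using Polynomial.induction_on' with
  | add p q hp hq => simpa using hp.add hq
  | monomial n c => simpa using (const c).mul (hf.pow n)

end IsSubpolynomial

namespace IsPowerDecaying

lemma zero : IsPowerDecaying fun _ => 0 := ⟨1, one_pos, isBigO_zero _ _⟩

lemma add {f g : ℕ → ℂ} (hf : IsPowerDecaying f) (hg : IsPowerDecaying g) :
    IsPowerDecaying fun M => f M + g M := by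
  obtain ⟨δ, hδ, hf⟩ := hf
  obtain ⟨η, hη, hg⟩ := hg
  exact ⟨min δ η, lt_min hδ hη,
    (hf.trans (rpow_natCast_isBigO_of_le (neg_le_neg (min_le_left _ _)))).add
      (hg.trans (rpow_natCast_isBigO_of_le (neg_le_neg (min_le_right _ _))))⟩

lemma subpolynomial_mul {f g : ℕ → ℂ} (hf : IsSubpolynomial f) (hg : IsPowerDecaying g) :
    IsPowerDecaying fun M => f M * g M := by
  obtain ⟨δ, hδ, hg⟩ := hg
  exact ⟨δ / 2, by linarith, isBigO_rpow_mul (hf (δ / 2) (by linarith)) hg (by linarith)⟩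

lemma const_mul {f : ℕ → ℂ} (c : ℂ) (hf : IsPowerDecaying f) :
    IsPowerDecaying fun M => c * f M :=
  subpolynomial_mul (.const c) hf

lemma tendsto_zero {f : ℕ → ℂ} (hf : IsPowerDecaying f) : Tendsto f atTop (nhds 0) := by
  obtain ⟨δ, hδ, hf⟩ := hf
  exact hf.trans_tendsto ((tendsto_rpow_neg_atTop hδ).comp tendsto_natCast_atTop_atTop)

end IsPowerDecaying

lemma exists_isPowerDecaying_sum_sub {b : ℕ → ℂ} {p : ℝ} (hp : 1 < p)
    (hb : b =O[atTop] fun M : ℕ => (M : ℝ) ^ (-p)) :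
    ∃ c, IsPowerDecaying fun M => ∑ n ∈ Finset.range M, b n - c := by
  have hsum : Summable b :=
    summable_of_isBigO_nat (Real.summable_nat_rpow.2 (neg_lt_neg hp)) hb
  set δ : ℝ := (p - 1) / 2 with hδ
  have hδ0 : 0 < δ := by rw [hδ]; linarith
  set w : ℕ → ℝ := fun n => ‖b n‖ * (n : ℝ) ^ δ with hw
  have hwO : w =O[atTop] fun M : ℕ => (M : ℝ) ^ (-p + δ) := by
    refine (hb.norm_left.mul (isBigO_refl (fun n : ℕ => (n : ℝ) ^ δ) atTop)).congr'
      EventuallyEq.rfl ?_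
    filter_upwards [eventually_ge_atTop 1] with M hM
    have hM' : (0 : ℝ) < M := by exact_mod_cast hM
    rw [Real.rpow_add hM']
  have hwsum : Summable w :=
    summable_of_isBigO_nat (Real.summable_nat_rpow.2 (by rw [hδ]; linarith)) hwO
  have hw0 : ∀ n, 0 ≤ w n := fun n => by positivity
  refine ⟨∑' n, b n, δ, hδ0, IsBigO.of_bound (∑' n, w n) ?_⟩
  filter_upwards [eventually_ge_atTop 1] with M hM
  have hM' : (0 : ℝ) < M := by exact_mod_cast hM
  have htail : ∑ n ∈ Finset.range M, b n - ∑' n, b n = -∑' n, b (n + M) := by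
    rw [← hsum.sum_add_tsum_nat_add M]; ring
  rw [htail, norm_neg, Real.norm_of_nonneg (by positivity)]
  have hws : Summable fun n => w (n + M) := (summable_nat_add_iff M).2 hwsum
  refine (tsum_of_norm_bounded (hws.mul_right ((M : ℝ) ^ (-δ))).hasSum fun n => ?_).trans ?_
  · have h1 : (M : ℝ) ^ δ ≤ ((n + M : ℕ) : ℝ) ^ δ := by
      gcongr; exact Nat.le_add_left M n
    have h2 : (1 : ℝ) ≤ ((n + M : ℕ) : ℝ) ^ δ * (M : ℝ) ^ (-δ) := by
      rw [Real.rpow_neg hM'.le, ← div_eq_mul_inv, one_le_div (by positivity)]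
      exact h1
    simp only [hw]
    rw [mul_assoc]
    exact le_mul_of_one_le_right (norm_nonneg _) h2
  · rw [tsum_mul_right]
    refine mul_le_mul_of_nonneg_right ?_ (by positivity)
    exact tsum_comp_le_tsum_of_inj hwsum hw0 (add_left_injective M)

/-! ### Multiple sums indexed by words -/

/-- The factor `a ^ (n + 1) / (n + 1) ^ s` attached to the letter `(s, a)`. -/
noncomputable def letterTerm (x : ℕ × ℂ) (n : ℕ) : ℂ :=
  x.2 ^ (n + 1) / ((n + 1 : ℕ) : ℂ) ^ x.1

/-- Multiplication by the factor of a letter followed by summation. -/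
noncomputable def letterSum (x : ℕ × ℂ) : (ℕ → ℂ) →ₗ[ℚ] (ℕ → ℂ) where
  toFun f M := ∑ n ∈ Finset.range M, letterTerm x n * f n
  map_add' f g := by ext M; simp [mul_add, Finset.sum_add_distrib]
  map_smul' c f := by ext M; simp [Finset.smul_sum]

/-- The partial multiple sums attached to a word in the letters `(s, a)`. -/
noncomputable def wordSum : List (ℕ × ℂ) → ℕ → ℂ
  | [] => 1
  | x :: u => letterSum x (wordSum u)

/-- The weight of a word. -/
def wordWeight (u : List (ℕ × ℂ)) : ℕ := (u.map Prod.fst).sum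

/-- Words whose exponents are positive and whose colors are `N`-th roots of unity. -/
def IsColoredWord (N : ℕ) (u : List (ℕ × ℂ)) : Prop := ∀ x ∈ u, 0 < x.1 ∧ x.2 ^ N = 1

open Classical in
/-- The number of letters `(1, 1)` at the beginning of a word. -/
noncomputable def leadingOnes : List (ℕ × ℂ) → ℕ
  | [] => 0
  | x :: u => if x = (1, 1) then leadingOnes u + 1 else 0

lemma letterSum_apply (x : ℕ × ℂ) (f : ℕ → ℂ) (M : ℕ) :
    letterSum x f M = ∑ n ∈ Finset.range M, letterTerm x n * f n := rfl

lemma letterSum_zero_right (x : ℕ × ℂ) (f : ℕ → ℂ) : letterSum x f 0 = 0 := by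
  simp [letterSum_apply]

lemma letterSum_succ (x : ℕ × ℂ) (f : ℕ → ℂ) (M : ℕ) :
    letterSum x f (M + 1) = letterSum x f M + letterTerm x M * f M := by
  simp [letterSum_apply, Finset.sum_range_succ]

lemma letterTerm_one_mul (x : ℕ × ℂ) (n : ℕ) :
    letterTerm (1, 1) n * letterTerm x n = letterTerm (x.1 + 1, x.2) n := by
  have : ((n + 1 : ℕ) : ℂ) ≠ 0 := Nat.cast_ne_zero.2 n.succ_ne_zero
  simp only [letterTerm]
  field_simp
  simp only [one_pow, mul_one, one_mul, pow_succ]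
  ring

/-- The quasi-shuffle recursion for multiplication by the harmonic numbers. -/
lemma wordSum_one_mul_cons (x : ℕ × ℂ) (u : List (ℕ × ℂ)) :
    wordSum [(1, 1)] * wordSum (x :: u) = wordSum ((1, 1) :: x :: u) +
      wordSum ((x.1 + 1, x.2) :: u) + letterSum x (wordSum [(1, 1)] * wordSum u) := by
  ext M
  induction M with
  | zero => simp [wordSum, letterSum_zero_right]
  | succ M ih =>
    simp only [wordSum, Pi.mul_apply, Pi.add_apply, letterSum_succ, Pi.one_apply] at ih ⊢
    rw [← letterTerm_one_mul]
    linear_combination ih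

lemma multiplePartialSum_restrict (k : ℕ) (s : Fin k → ℕ) (a : Fin k → ℂ) (M m : ℕ)
    (hm : m ≤ M) :
    (∑ n : Fin k → Fin (M + 1),
      if ((∀ i j : Fin k, i < j → (n j : ℕ) < (n i : ℕ)) ∧ (∀ i, 0 < (n i : ℕ))) ∧
          ∀ i, (n i : ℕ) ≤ m then
        ∏ i, (a i) ^ (n i : ℕ) / ((n i : ℕ) : ℂ) ^ (s i)
      else 0) = wordSum (List.ofFn fun i => (s i, a i)) m := by
  induction k generalizing m with
  | zero => simp [wordSum]
  | succ k ih =>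
    rw [List.ofFn_succ, wordSum, letterSum_apply,
      ← (Fin.consEquiv fun _ : Fin (k + 1) => Fin (M + 1)).sum_comp, Fintype.sum_prod_type]
    have key : ∀ x : Fin (M + 1), (∑ y : Fin k → Fin (M + 1),
        if ((∀ i j : Fin (k + 1), i < j →
            ((Fin.cons x y : Fin (k + 1) → Fin (M + 1)) j : ℕ) <
              ((Fin.cons x y : Fin (k + 1) → Fin (M + 1)) i : ℕ)) ∧
            (∀ i, 0 < ((Fin.cons x y : Fin (k + 1) → Fin (M + 1)) i : ℕ))) ∧
            ∀ i, ((Fin.cons x y : Fin (k + 1) → Fin (M + 1)) i : ℕ) ≤ m then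
          ∏ i, (a i) ^ ((Fin.cons x y : Fin (k + 1) → Fin (M + 1)) i : ℕ) /
            (((Fin.cons x y : Fin (k + 1) → Fin (M + 1)) i : ℕ) : ℂ) ^ (s i)
        else 0) =
        if 0 < (x : ℕ) ∧ (x : ℕ) ≤ m then
          letterTerm (s 0, a 0) (x - 1) *
            wordSum (List.ofFn fun i : Fin k => (s i.succ, a i.succ)) (x - 1)
        else 0 := by
      intro x
      split_ifs with hx
      · rw [← ih (fun i => s i.succ) (fun i => a i.succ) (x - 1) (by omega), Finset.mul_sum]
        refine Finset.sum_congr rfl fun y _ => ?_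
        have hiff : (((∀ i j : Fin (k + 1), i < j →
            ((Fin.cons x y : Fin (k + 1) → Fin (M + 1)) j : ℕ) <
              ((Fin.cons x y : Fin (k + 1) → Fin (M + 1)) i : ℕ)) ∧
            (∀ i, 0 < ((Fin.cons x y : Fin (k + 1) → Fin (M + 1)) i : ℕ))) ∧
            ∀ i, ((Fin.cons x y : Fin (k + 1) → Fin (M + 1)) i : ℕ) ≤ m) ↔
            (((∀ i j : Fin k, i < j → (y j : ℕ) < (y i : ℕ)) ∧ (∀ i, 0 < (y i : ℕ))) ∧
              ∀ i, (y i : ℕ) ≤ x - 1) := by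
          simp only [Fin.forall_fin_succ, Fin.cons_zero, Fin.cons_succ, Fin.succ_lt_succ_iff]
          simp only [lt_self_iff_false, Fin.not_lt_zero, Fin.succ_pos, false_imp_iff, true_imp_iff,
            true_and]
          constructor
          · rintro ⟨⟨⟨h1, h2⟩, h3, h4⟩, h5, h6⟩
            exact ⟨⟨h2, h4⟩, fun i => by have := h1 i; omega⟩
          · rintro ⟨⟨h2, h4⟩, h1⟩
            exact ⟨⟨⟨fun i => by have := h1 i; omega, h2⟩, hx.1, h4⟩, hx.2,
              fun i => by have := h1 i; omega⟩
        rw [if_congr hiff rfl rfl, mul_ite, mul_zero, Fin.prod_univ_succ]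
        simp only [Fin.cons_zero, Fin.cons_succ, letterTerm, Nat.sub_add_cancel hx.1]
      · refine Finset.sum_eq_zero fun y _ => if_neg fun h => hx ⟨?_, ?_⟩
        · simpa using h.1.2 0
        · simpa using h.2 0
    refine (Finset.sum_congr rfl fun x _ => key x).trans ?_
    rw [Fin.sum_univ_eq_sum_range (fun x : ℕ => if 0 < x ∧ x ≤ m then
        letterTerm (s 0, a 0) (x - 1) *
          wordSum (List.ofFn fun i : Fin k => (s i.succ, a i.succ)) (x - 1) else 0) (M + 1),
      Finset.sum_range_succ']
    simp only [Nat.add_sub_cancel, Nat.succ_pos, true_and, lt_self_iff_false, false_and, if_false,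
      add_zero]
    rw [← Finset.sum_filter]
    refine Finset.sum_congr ?_ fun _ _ => rfl
    ext n
    simp only [Finset.mem_filter, Finset.mem_range]
    omega

lemma multiplePartialSum_eq_wordSum (k : ℕ) (s : Fin k → ℕ) (a : Fin k → ℂ) :
    multiplePartialSum k s a = wordSum (List.ofFn fun i => (s i, a i)) := by
  ext M
  rw [← multiplePartialSum_restrict k s a M M le_rfl, multiplePartialSum]
  refine Finset.sum_congr rfl fun n _ => if_congr ?_ rfl rfl
  exact (and_iff_left fun i => Nat.lt_succ_iff.1 (n i).2).symm

lemma norm_letterTerm {N : ℕ} (hN : 0 < N) {x : ℕ × ℂ} (hx : x.2 ^ N = 1) (n : ℕ) :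
    ‖letterTerm x n‖ = 1 / ((n + 1 : ℕ) : ℝ) ^ x.1 := by
  rw [letterTerm, norm_div, norm_pow, norm_pow, Complex.norm_eq_one_of_pow_eq_one hx hN.ne',
    one_pow, Complex.norm_natCast]

lemma wordSum_one_eq_harmonic (M : ℕ) : wordSum [(1, 1)] M = ((harmonic M : ℝ) : ℂ) := by
  simp [wordSum, letterSum_apply, letterTerm, harmonic]

lemma harmonic_isSubpolynomial : IsSubpolynomial fun M => ((harmonic M : ℝ) : ℂ) := by
  refine ((IsSubpolynomial.const 1).add .log).of_norm_le fun M => ?_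
  have h0 : (0 : ℝ) ≤ harmonic M := by
    exact_mod_cast Finset.sum_nonneg fun i _ => by positivity
  have h1 := harmonic_le_one_add_log M
  rw [← Complex.ofReal_one, ← Complex.ofReal_add, Complex.norm_real, Complex.norm_real,
    Real.norm_of_nonneg h0, Real.norm_of_nonneg (h0.trans h1)]
  exact h1

lemma norm_wordSum_le_harmonic_pow {N : ℕ} (hN : 0 < N) {u : List (ℕ × ℂ)}
    (hu : IsColoredWord N u) (M : ℕ) : ‖wordSum u M‖ ≤ (harmonic M : ℝ) ^ u.length := by
  induction u generalizing M with
  | nil => simp [wordSum]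
  | cons x u ih =>
    have hx := hu x (by simp)
    have hmono : ∀ n < M, (harmonic n : ℝ) ≤ harmonic M := fun n hn => by
      exact_mod_cast Finset.sum_le_sum_of_subset_of_nonneg
        (Finset.range_mono hn.le) fun i _ _ => by positivity
    have h0 : ∀ n, (0 : ℝ) ≤ harmonic n := fun n => by
      exact_mod_cast Finset.sum_nonneg fun i _ => by positivity
    have hH : (harmonic M : ℝ) = ∑ n ∈ Finset.range M, 1 / ((n + 1 : ℕ) : ℝ) := by
      simp [harmonic]
    rw [wordSum, letterSum_apply, List.length_cons, pow_succ']
    conv_rhs => rw [hH, Finset.sum_mul]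
    rw [← hH]
    refine norm_sum_le_of_le _ fun n hn => ?_
    rw [norm_mul, norm_letterTerm hN hx.2]
    have hn' : (1 : ℝ) ≤ ((n + 1 : ℕ) : ℝ) := by exact_mod_cast Nat.succ_pos n
    have hle := ih (fun y hy => hu y (by simp [hy])) n
    refine mul_le_mul ?_ (hle.trans ?_) (norm_nonneg _) (by positivity)
    · exact one_div_le_one_div_of_le (by positivity) (le_self_pow₀ hn' hx.1.ne')
    · exact pow_le_pow_left₀ (h0 n) (hmono n (Finset.mem_range.1 hn)) _

lemma wordSum_isSubpolynomial {N : ℕ} (hN : 0 < N) {u : List (ℕ × ℂ)}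
    (hu : IsColoredWord N u) : IsSubpolynomial (wordSum u) := by
  refine (harmonic_isSubpolynomial.pow u.length).of_norm_le fun M => ?_
  refine (norm_wordSum_le_harmonic_pow hN hu M).trans ?_
  rw [norm_pow, Complex.norm_real]
  exact pow_le_pow_left₀ (by exact_mod_cast Finset.sum_nonneg fun i _ => by positivity)
    (le_abs_self _) _

lemma one_div_pow_isBigO_rpow (d c : ℕ) :
    (fun n : ℕ => 1 / ((n + c : ℕ) : ℂ) ^ d) =O[atTop] fun n : ℕ => (n : ℝ) ^ (-d : ℝ) := by
  refine IsBigO.of_bound 1 ?_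
  filter_upwards [eventually_ge_atTop 1] with n hn
  have hn' : (0 : ℝ) < n := by exact_mod_cast hn
  rw [norm_div, norm_one, norm_pow, Complex.norm_natCast, Real.norm_of_nonneg (by positivity),
    one_mul, Real.rpow_neg hn'.le, Real.rpow_natCast, ← one_div]
  refine one_div_le_one_div_of_le (by positivity) (pow_le_pow_left₀ hn'.le ?_ _)
  exact_mod_cast Nat.le_add_right n c

lemma letterTerm_isBigO {N : ℕ} (hN : 0 < N) {x : ℕ × ℂ} (hx : x.2 ^ N = 1) :
    letterTerm x =O[atTop] fun n : ℕ => (n : ℝ) ^ (-x.1 : ℝ) := by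
  refine (IsBigO.of_bound 1 (.of_forall fun n => ?_)).trans (one_div_pow_isBigO_rpow x.1 1)
  rw [norm_letterTerm hN hx, norm_div, norm_one, norm_pow, Complex.norm_natCast, one_mul]

lemma wordSum_succ_sub_isBigO {N : ℕ} (hN : 0 < N) {u : List (ℕ × ℂ)}
    (hu : IsColoredWord N u) {ε : ℝ} (hε : 0 < ε) :
    (fun n => wordSum u (n + 1) - wordSum u n) =O[atTop] fun n : ℕ => (n : ℝ) ^ (-1 + ε) := by
  cases u with
  | nil => simpa [wordSum] using isBigO_zero _ _
  | cons x u =>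
    have hx := hu x (by simp)
    simp only [wordSum, letterSum_succ, add_sub_cancel_left]
    refine isBigO_rpow_mul (letterTerm_isBigO hN hx.2)
      (wordSum_isSubpolynomial hN (fun y hy => hu y (by simp [hy])) ε hε) ?_
    have : (1 : ℝ) ≤ x.1 := by exact_mod_cast hx.1
    linarith

lemma sum_range_sub_mul (t f : ℕ → ℂ) (M : ℕ) :
    ∑ n ∈ Finset.range M, (t (n + 1) - t n) * f n =
      t M * f M - t 0 * f 0 - ∑ n ∈ Finset.range M, t (n + 1) * (f (n + 1) - f n) := by
  induction M with
  | zero => simp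
  | succ M ih => rw [Finset.sum_range_succ, Finset.sum_range_succ, ih]; ring

lemma exists_isPowerDecaying_wordSum_sub {N : ℕ} (hN : 0 < N) {x : ℕ × ℂ}
    {u : List (ℕ × ℂ)} (hu : IsColoredWord N (x :: u)) (hx : x ≠ (1, 1)) :
    ∃ c, IsPowerDecaying fun M => wordSum (x :: u) M - c := by
  have hx' := hu x (by simp)
  have hu' : IsColoredWord N u := fun y hy => hu y (by simp [hy])
  have hsub := wordSum_isSubpolynomial hN hu'
  rcases Nat.lt_or_ge 1 x.1 with h2 | h1
  · refine exists_isPowerDecaying_sum_sub (p := 3 / 2) (by norm_num) ?_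
    refine isBigO_rpow_mul (letterTerm_isBigO hN hx'.2) (hsub (1 / 2) (by norm_num)) ?_
    have : (2 : ℝ) ≤ x.1 := by exact_mod_cast h2
    linarith
  · obtain ⟨s, a⟩ := x
    obtain rfl : s = 1 := le_antisymm h1 hx'.1
    have ha : a - 1 ≠ 0 := sub_ne_zero.2 fun h => hx (by rw [h])
    have hnorm : ‖a‖ = 1 := Complex.norm_eq_one_of_pow_eq_one hx'.2 hN.ne'
    set t : ℕ → ℂ := fun n => a ^ (n + 1) / (a - 1) with ht
    set f : ℕ → ℂ := fun n => 1 / ((n + 1 : ℕ) : ℂ) ^ 1 * wordSum u n with hf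
    have htO : ∀ c : ℕ, (fun n => t (n + c)) =O[atTop] fun n : ℕ => (n : ℝ) ^ (0 : ℝ) := by
      intro c
      refine IsBigO.of_bound (1 / ‖a - 1‖) (.of_forall fun n => ?_)
      simp [ht, hnorm]
    have hfO : f =O[atTop] fun n : ℕ => (n : ℝ) ^ (-(1 / 2) : ℝ) :=
      isBigO_rpow_mul (one_div_pow_isBigO_rpow 1 1) (hsub (1 / 2) (by norm_num)) (by norm_num)
    have hdf : (fun n => f (n + 1) - f n) =O[atTop] fun n : ℕ => (n : ℝ) ^ (-(3 / 2) : ℝ) := by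
      have e : (fun n => f (n + 1) - f n) = fun n =>
          1 / ((n + 2 : ℕ) : ℂ) ^ 1 * (wordSum u (n + 1) - wordSum u n) -
            1 / ((n + 2 : ℕ) : ℂ) ^ 1 * (1 / ((n + 1 : ℕ) : ℂ) ^ 1 * wordSum u n) := by
        ext n
        have h1 : ((n : ℂ) + 1) ≠ 0 := by exact_mod_cast n.succ_ne_zero
        have h2 : ((n : ℂ) + 2) ≠ 0 := by exact_mod_cast (n + 1).succ_ne_zero
        have h3 : ((n : ℂ) + 1 + 1) ≠ 0 := by exact_mod_cast (n + 1).succ_ne_zero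
        simp only [hf]
        push_cast
        field_simp
        ring
      rw [e]
      refine (isBigO_rpow_mul (one_div_pow_isBigO_rpow 1 2)
        (wordSum_succ_sub_isBigO hN hu' (ε := 1 / 2) (by norm_num)) (by norm_num)).sub
        (isBigO_rpow_mul (one_div_pow_isBigO_rpow 1 2) hfO (by norm_num))
    obtain ⟨c, hc⟩ := exists_isPowerDecaying_sum_sub (b := fun n => t (n + 1) * (f (n + 1) - f n))
      (p := 3 / 2) (by norm_num) (isBigO_rpow_mul (htO 1) hdf (by norm_num))
    have hboundary : IsPowerDecaying fun M => t M * f M :=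
      ⟨1 / 2, by norm_num, isBigO_rpow_mul (htO 0) hfO (by norm_num)⟩
    refine ⟨-(t 0 * f 0) - c, ?_⟩
    convert hboundary.add (hc.const_mul (-1)) using 2 with M
    have hterm : ∀ n, letterTerm (1, a) n * wordSum u n = (t (n + 1) - t n) * f n := by
      intro n
      simp only [ht, hf, letterTerm]
      field_simp
      ring
    rw [wordSum, letterSum_apply, Finset.sum_congr rfl fun n _ => hterm n, sum_range_sub_mul]
    ring

/-! ### Expansions in powers of `log M + γ` -/

/-- `f M = P (log M + γ)` up to an error decaying like a negative power of `M`. -/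
def HasLogExpansion (f : ℕ → ℂ) (P : ℂ[X]) : Prop :=
  IsPowerDecaying fun M =>
    f M - P.eval (((Real.log M + Real.eulerMascheroniConstant : ℝ) : ℂ))

lemma harmonic_sub_isPowerDecaying : IsPowerDecaying fun M =>
    ((harmonic M : ℝ) : ℂ) - ((Real.log M + Real.eulerMascheroniConstant : ℝ) : ℂ) := by
  refine ⟨1, one_pos, IsBigO.of_bound 1 ?_⟩
  filter_upwards [eventually_ge_atTop 1] with M hM
  have hM' : (0 : ℝ) < M := by exact_mod_cast hM
  have h1 := Real.eulerMascheroniSeq_lt_eulerMascheroniConstant M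
  have h2 := Real.eulerMascheroniConstant_lt_eulerMascheroniSeq' M
  rw [Real.eulerMascheroniSeq] at h1
  rw [Real.eulerMascheroniSeq', if_neg (by omega)] at h2
  have h3 : Real.log (M + 1) - Real.log M ≤ 1 / M := by
    rw [← Real.log_div (by positivity) hM'.ne']
    refine (Real.log_le_sub_one_of_pos (by positivity)).trans (le_of_eq ?_)
    field_simp
    ring
  rw [← Complex.ofReal_sub, Complex.norm_real, Real.norm_of_nonneg (by linarith),
    Real.rpow_neg_one, one_mul, ← one_div, Real.norm_of_nonneg (by positivity)]
  linarith

lemma HasLogExpansion.harmonic_mul {f : ℕ → ℂ} {P : ℂ[X]} (hf : HasLogExpansion f P) :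
    HasLogExpansion (wordSum [(1, 1)] * f) (X * P) := by
  have hT : IsSubpolynomial fun M : ℕ =>
      ((Real.log M + Real.eulerMascheroniConstant : ℝ) : ℂ) := by
    simpa using IsSubpolynomial.log.add (.const (Real.eulerMascheroniConstant : ℂ))
  have h := (IsPowerDecaying.subpolynomial_mul harmonic_isSubpolynomial hf).add
    (IsPowerDecaying.subpolynomial_mul (hT.polynomial_eval P) harmonic_sub_isPowerDecaying)
  unfold HasLogExpansion
  convert h using 2 with M
  rw [Pi.mul_apply, wordSum_one_eq_harmonic, eval_mul, eval_X]
  ring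

/-- Sequences with a logarithmic expansion whose constant term is a colored multiple zeta value
combination of level `N` and weight `w`. -/
noncomputable def regularSequences (N w : ℕ) : Submodule ℚ (ℕ → ℂ) where
  carrier := {f | ∃ P : ℂ[X], P.coeff 0 ∈ CMZV N w ∧ HasLogExpansion f P}
  zero_mem' := ⟨0, by simp, by simpa [HasLogExpansion] using IsPowerDecaying.zero⟩
  add_mem' := by
    rintro f g ⟨P, hP, hf⟩ ⟨Q, hQ, hg⟩
    refine ⟨P + Q, by simpa using add_mem hP hQ, ?_⟩
    unfold HasLogExpansion
    convert hf.add hg using 2 with M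
    rw [Pi.add_apply, eval_add]
    ring
  smul_mem' := by
    rintro q f ⟨P, hP, hf⟩
    refine ⟨C (q : ℂ) * P, by simpa [Rat.smul_def] using (CMZV N w).smul_mem q hP, ?_⟩
    unfold HasLogExpansion
    convert hf.const_mul (q : ℂ) using 2 with M
    rw [Pi.smul_apply, Rat.smul_def, eval_mul, eval_C]
    ring

/-- The span of the sums of colored words of weight `w` with at most `l` leading letters
`(1, 1)`. -/
noncomputable def wordSpan (N w l : ℕ) : Submodule ℚ (ℕ → ℂ) :=
  Submodule.span ℚ
    {f | ∃ u, IsColoredWord N u ∧ wordWeight u = w ∧ leadingOnes u ≤ l ∧ f = wordSum u}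

lemma wordSum_mem_wordSpan {N l : ℕ} {u : List (ℕ × ℂ)} (hu : IsColoredWord N u)
    (hl : leadingOnes u ≤ l) : wordSum u ∈ wordSpan N (wordWeight u) l :=
  Submodule.subset_span ⟨u, hu, rfl, hl, rfl⟩

lemma IsColoredWord.cons {N : ℕ} {x : ℕ × ℂ} {u : List (ℕ × ℂ)} (hu : IsColoredWord N u)
    (h0 : 0 < x.1) (h1 : x.2 ^ N = 1) : IsColoredWord N (x :: u) := by
  rintro y hy
  rcases List.mem_cons.1 hy with rfl | hy
  exacts [⟨h0, h1⟩, hu y hy]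

lemma IsColoredWord.tail {N : ℕ} {x : ℕ × ℂ} {u : List (ℕ × ℂ)}
    (hu : IsColoredWord N (x :: u)) : IsColoredWord N u :=
  fun y hy => hu y (List.mem_cons_of_mem x hy)

lemma wordWeight_cons (x : ℕ × ℂ) (u : List (ℕ × ℂ)) :
    wordWeight (x :: u) = x.1 + wordWeight u := by
  simp [wordWeight]

lemma leadingOnes_one_cons (u : List (ℕ × ℂ)) :
    leadingOnes ((1, 1) :: u) = leadingOnes u + 1 := by
  simp [leadingOnes]

lemma leadingOnes_cons_of_ne {x : ℕ × ℂ} (hx : x ≠ (1, 1)) (u : List (ℕ × ℂ)) :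
    leadingOnes (x :: u) = 0 := by
  simp [leadingOnes, hx]

lemma letterSum_mem_wordSpan {N w l l' : ℕ} {x : ℕ × ℂ} (h0 : 0 < x.1) (h1 : x.2 ^ N = 1)
    (hl : ∀ u, leadingOnes u ≤ l → leadingOnes (x :: u) ≤ l') {f : ℕ → ℂ}
    (hf : f ∈ wordSpan N w l) : letterSum x f ∈ wordSpan N (x.1 + w) l' := by
  have hle : wordSpan N w l ≤ (wordSpan N (x.1 + w) l').comap (letterSum x) := by
    refine Submodule.span_le.2 ?_
    rintro _ ⟨u, hu, rfl, hul, rfl⟩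
    rw [← wordWeight_cons]
    exact wordSum_mem_wordSpan (hu.cons h0 h1) (hl u hul)
  exact hle hf

/-- Multiplying by a harmonic number adds a leading letter `(1, 1)`, up to words with fewer
leading letters `(1, 1)`. -/
lemma wordSum_one_mul_sub_mem {N : ℕ} {u : List (ℕ × ℂ)} (hu : IsColoredWord N u) :
    wordSum [(1, 1)] * wordSum u - ((leadingOnes u + 1 : ℕ) : ℚ) • wordSum ((1, 1) :: u) ∈
      wordSpan N (1 + wordWeight u) (leadingOnes u) := by
  induction u with
  | nil => simp [leadingOnes, wordSum]
  | cons x u ih =>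
    have hx := hu x (by simp)
    have ih := ih hu.tail
    have hx2 : (x.1 + 1, x.2) ≠ ((1, 1) : ℕ × ℂ) := fun h => by
      have := (Prod.ext_iff.1 h).1
      simp only at this
      omega
    have hmem2 : wordSum ((x.1 + 1, x.2) :: u) ∈
        wordSpan N (1 + wordWeight (x :: u)) (leadingOnes (x :: u)) := by
      have h := wordSum_mem_wordSpan (l := leadingOnes (x :: u))
        (hu.tail.cons (x := (x.1 + 1, x.2)) (by simp) hx.2)
        (by simp [leadingOnes_cons_of_ne hx2])
      have hw : wordWeight ((x.1 + 1, x.2) :: u) = 1 + wordWeight (x :: u) := by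
        simp only [wordWeight_cons]; ring
      rwa [hw] at h
    rw [wordSum_one_mul_cons]
    have hw : 1 + wordWeight (x :: u) = x.1 + (1 + wordWeight u) := by
      rw [wordWeight_cons]; ring
    by_cases h : x = (1, 1)
    · subst h
      have h3 := letterSum_mem_wordSpan (l' := leadingOnes u + 1) hx.1 hx.2
        (fun v hv => by rw [leadingOnes_one_cons]; omega) ih
      rw [← hw, ← leadingOnes_one_cons] at h3
      convert add_mem hmem2 h3 using 1
      rw [map_sub, map_smul, leadingOnes_one_cons]
      have e : letterSum (1, 1) (wordSum ((1, 1) :: u)) = wordSum ((1, 1) :: (1, 1) :: u) := rfl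
      rw [e]
      push_cast
      module
    · have hall : wordSum [(1, 1)] * wordSum u ∈ wordSpan N (1 + wordWeight u)
          (leadingOnes u + 1) := by
        have hle : wordSpan N (1 + wordWeight u) (leadingOnes u) ≤
            wordSpan N (1 + wordWeight u) (leadingOnes u + 1) :=
          Submodule.span_mono fun f ⟨v, h1, h2, h3, h4⟩ => ⟨v, h1, h2, h3.trans (by omega), h4⟩
        have h4 : wordSum ((1, 1) :: u) ∈ wordSpan N (1 + wordWeight u) (leadingOnes u + 1) := by
          have := wordSum_mem_wordSpan (l := leadingOnes u + 1)
            (hu.tail.cons (x := (1, 1)) one_pos (one_pow N)) (leadingOnes_one_cons u).le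
          rwa [wordWeight_cons] at this
        exact (Submodule.sub_mem_iff_left _ (Submodule.smul_mem _ _ h4)).1 (hle ih)
      have h3 := letterSum_mem_wordSpan (l' := leadingOnes (x :: u)) hx.1 hx.2
        (fun v _ => by simp [leadingOnes_cons_of_ne h]) hall
      rw [← hw] at h3
      convert add_mem hmem2 h3 using 1
      rw [leadingOnes_cons_of_ne h]
      push_cast
      module

lemma isCMZV_of_tendsto_wordSum {N : ℕ} {x : ℕ × ℂ} {u : List (ℕ × ℂ)}
    (hu : IsColoredWord N (x :: u)) (hx : x ≠ (1, 1)) {c : ℂ}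
    (hc : Tendsto (wordSum (x :: u)) atTop (nhds c)) : IsCMZV N (wordWeight (x :: u)) c := by
  refine ⟨(x :: u).length, by simp, fun i => ((x :: u).get i).1, fun i => ((x :: u).get i).2,
    fun i => (hu _ (List.get_mem _ i)).1, ?_, fun i => (hu _ (List.get_mem _ i)).2, ?_, ?_⟩
  · rw [wordWeight, ← List.sum_ofFn]
    congr 1
    conv_rhs => rw [← List.ofFn_get (x :: u), List.map_ofFn]
    rfl
  · rintro ⟨h1, h2⟩
    exact hx (Prod.ext h1 h2)
  · rw [multiplePartialSum_eq_wordSum]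
    convert hc using 2
    exact List.ofFn_get (x :: u)

lemma wordSum_mem_regularSequences {N : ℕ} (hN : 0 < N) (l : ℕ) {u : List (ℕ × ℂ)}
    (hu : IsColoredWord N u) (hne : u ≠ []) (hl : leadingOnes u ≤ l) :
    wordSum u ∈ regularSequences N (wordWeight u) := by
  induction l generalizing u with
  | zero =>
    obtain ⟨x, u, rfl⟩ := List.exists_cons_of_ne_nil hne
    have hx : x ≠ (1, 1) := by
      rintro rfl
      rw [leadingOnes_one_cons] at hl
      omega
    obtain ⟨c, hc⟩ := exists_isPowerDecaying_wordSum_sub hN hu hx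
    refine ⟨C c, ?_, by simpa [HasLogExpansion] using hc⟩
    rw [coeff_C_zero]
    exact Submodule.subset_span (isCMZV_of_tendsto_wordSum hu hx
      (tendsto_sub_nhds_zero_iff.1 hc.tendsto_zero))
  | succ l ih =>
    rcases Nat.lt_or_ge l (leadingOnes u) with hlt | hle
    swap
    · exact ih hu hne hle
    obtain ⟨x, u, rfl⟩ := List.exists_cons_of_ne_nil hne
    have hx : x = (1, 1) := by
      by_contra hx
      rw [leadingOnes_cons_of_ne hx] at hlt
      omega
    subst hx
    rw [leadingOnes_one_cons] at hl
    have hul : leadingOnes u ≤ l := by omega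
    have hexp : ∃ P, HasLogExpansion (wordSum u) P := by
      by_cases hnil : u = []
      · subst hnil
        exact ⟨1, by simpa [HasLogExpansion, wordSum] using IsPowerDecaying.zero⟩
      · obtain ⟨P, -, hP⟩ := ih hu.tail hnil hul
        exact ⟨P, hP⟩
    obtain ⟨P, hP⟩ := hexp
    have hmul : wordSum [(1, 1)] * wordSum u ∈ regularSequences N (1 + wordWeight u) :=
      ⟨X * P, by simp, hP.harmonic_mul⟩
    have hspan : wordSpan N (1 + wordWeight u) (leadingOnes u) ≤
        regularSequences N (1 + wordWeight u) := by
      refine Submodule.span_le.2 ?_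
      rintro _ ⟨v, hv, hvw, hvl, rfl⟩
      rw [← hvw]
      refine ih hv ?_ (hvl.trans hul)
      rintro rfl
      simp [wordWeight] at hvw
      omega
    have h := (Submodule.sub_mem_iff_right _ hmul).1 (hspan (wordSum_one_mul_sub_mem hu.tail))
    rw [wordWeight_cons]
    exact (Submodule.smul_mem_iff _ (by positivity)).1 h

/-- For `N > 0`, positive integers `s₁,…,s_k` and `N`-th roots of unity
`a₁,…,a_k`, the partial sums `H_M = ∑_{M ≥ n₁ > ⋯ > n_k ≥ 1} a₁^{n₁}⋯a_k^{n_k}/(n₁^{s₁}⋯n_k^{s_k})`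
satisfy `H_M = P(log M + γ) + c + o(1)` as `M → ∞` for some polynomial `P` with zero constant
term and some `c ∈ CMZV^N_{s₁+⋯+s_k}`. -/
theorem statement10 (N : ℕ) (hN : 0 < N) (k : ℕ) (hk : 0 < k)
    (s : Fin k → ℕ) (hs : ∀ i, 0 < s i) (a : Fin k → ℂ) (ha : ∀ i, (a i) ^ N = 1) :
    ∃ P : Polynomial ℂ, P.coeff 0 = 0 ∧ ∃ c ∈ CMZV N (∑ i, s i),
      Filter.Tendsto
        (fun M : ℕ =>
          multiplePartialSum k s a M
            - P.eval (((Real.log M + Real.eulerMascheroniConstant : ℝ) : ℂ)) - c)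
        Filter.atTop (nhds 0) := by
  have hword : IsColoredWord N (List.ofFn fun i => (s i, a i)) := by
    intro x hx
    obtain ⟨i, rfl⟩ := (List.mem_ofFn' _ _).1 hx
    exact ⟨hs i, ha i⟩
  have hne : (List.ofFn fun i => (s i, a i)) ≠ [] := by
    rw [Ne, List.ofFn_eq_nil_iff]
    exact hk.ne'
  have hweight : wordWeight (List.ofFn fun i => (s i, a i)) = ∑ i, s i := by
    rw [wordWeight, List.map_ofFn, List.sum_ofFn]
    rfl
  obtain ⟨P, hP, hexp⟩ := wordSum_mem_regularSequences hN _ hword hne le_rfl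
  rw [hweight] at hP
  refine ⟨P - C (P.coeff 0), by simp, P.coeff 0, hP, ?_⟩
  rw [multiplePartialSum_eq_wordSum]
  convert hexp.tendsto_zero using 2 with M
  rw [eval_sub, eval_C]
  ring
end

section
/- ∑_{n=2}^∞ (H_{n−1}^{(2)}/n³)·2ⁿ·binom(2n,n)^{−1} = π³C/24 − π·β(4) − 3π²ζ(3)/128 + 527ζ(5)/256 + π⁴·log 2/384, where H_{n−1}^{(2)} = ∑_{k=1}^{n−1} 1/k². -/
/-- Catalan's constant `C = ∑_{k≥0} (-1)^k/(2k+1)²`. -/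
noncomputable def catalanConst : ℝ := ∑' k : ℕ, (-1 : ℝ) ^ k / ((2 * k + 1 : ℕ) : ℝ) ^ 2

/-- `β(4) = ∑_{k≥0} (-1)^k/(2k+1)⁴`. -/
noncomputable def diriBeta4 : ℝ := ∑' k : ℕ, (-1 : ℝ) ^ k / ((2 * k + 1 : ℕ) : ℝ) ^ 4

/-- The real polylogarithm `Li_s(x) = ∑_{n≥1} xⁿ/n^s`. -/
noncomputable def rpolylog (s : ℕ) (x : ℝ) : ℝ :=
  ∑' n : ℕ, x ^ (n + 1) / ((n + 1 : ℕ) : ℝ) ^ s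

/-- The complex polylogarithm `Li_s(z) = ∑_{n≥1} zⁿ/n^s`. -/
noncomputable def cpolylog (s : ℕ) (z : ℂ) : ℂ :=
  ∑' n : ℕ, z ^ (n + 1) / ((n + 1 : ℕ) : ℂ) ^ s

namespace CentralBinomSeries

open Real Set Filter Topology MeasureTheory

/-- The ratio `4 ^ (n + 1) / centralBinom n`. -/
noncomputable def wallis (n : ℕ) : ℝ := 4 ^ (n + 1) / (n.centralBinom : ℝ)

/-- The harmonic number `∑_{k ≤ n} 1 / k²`. -/
noncomputable def harmonicSq (n : ℕ) : ℝ := ∑ k ∈ Finset.Icc 1 n, (1 : ℝ) / (k : ℝ) ^ 2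

/-- The coefficients `4 ^ n / (n² centralBinom n)` of the expansion of `2 arcsin²`. -/
noncomputable def arcsinCoeff (n : ℕ) : ℝ := wallis n / (4 * (n : ℝ) ^ 2)

/-- Partial sums of the arcsine series at `sin t`, weighted by `a`. -/
noncomputable def weightedSum (a : ℕ → ℝ) (N : ℕ) (t : ℝ) : ℝ :=
  ∑ n ∈ Finset.range N, a n * arcsinCoeff (n + 1) * sin t ^ (2 * (n + 1))

/-- The derivative of `weightedSum`. -/
noncomputable def weightedSumDeriv (a : ℕ → ℝ) (N : ℕ) (t : ℝ) : ℝ :=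
  ∑ n ∈ Finset.range N,
    a n * arcsinCoeff (n + 1) * ((2 * (n + 1)) * sin t ^ (2 * n + 1) * cos t)

lemma wallis_zero : wallis 0 = 4 := by simp [wallis]

lemma wallis_pos (n : ℕ) : 0 < wallis n := by
  have : 0 < (n.centralBinom : ℝ) := by exact_mod_cast n.centralBinom_pos
  unfold wallis
  positivity

lemma wallis_le (n : ℕ) (hn : 0 < n) : wallis n ≤ 8 * n := by
  have h0 : 0 < (n.centralBinom : ℝ) := by exact_mod_cast n.centralBinom_pos
  have h : (4 : ℝ) ^ n ≤ 2 * n * n.centralBinom := by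
    exact_mod_cast Nat.four_pow_le_two_mul_self_mul_centralBinom n hn
  unfold wallis
  rw [div_le_iff₀ h0, pow_succ]
  linarith

lemma wallis_succ (n : ℕ) : (2 * (n : ℝ) + 1) * wallis (n + 1) = 2 * (n + 1) * wallis n := by
  have h0 : (n.centralBinom : ℝ) ≠ 0 := by exact_mod_cast n.centralBinom_ne_zero
  have h1 : ((n + 1).centralBinom : ℝ) ≠ 0 := by exact_mod_cast (n + 1).centralBinom_ne_zero
  have h : ((n : ℝ) + 1) * (n + 1).centralBinom = 2 * (2 * n + 1) * n.centralBinom := by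
    exact_mod_cast n.succ_mul_centralBinom_succ
  unfold wallis
  rw [mul_div_assoc', mul_div_assoc', div_eq_div_iff h1 h0, pow_succ 4 (n + 1)]
  linear_combination (-2 * 4 ^ (n + 1)) * h

lemma arcsinCoeff_succ (n : ℕ) : 4 * ((n : ℝ) + 1) ^ 2 * arcsinCoeff (n + 1) = wallis (n + 1) := by
  unfold arcsinCoeff
  have : (n : ℝ) + 1 ≠ 0 := by positivity
  push_cast
  field_simp

lemma arcsinCoeff_succ' (n : ℕ) :
    (2 * ((n : ℝ) + 1)) * (2 * n + 1) * arcsinCoeff (n + 1) = wallis n := by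
  have h1 := arcsinCoeff_succ n
  have h2 := wallis_succ n
  have : (n : ℝ) + 1 ≠ 0 := by positivity
  apply mul_left_cancel₀ (mul_ne_zero two_ne_zero this)
  rw [← h2, ← h1]
  ring

lemma harmonicSq_succ (n : ℕ) : harmonicSq (n + 1) = harmonicSq n + 1 / ((n : ℝ) + 1) ^ 2 := by
  unfold harmonicSq
  rw [Finset.sum_Icc_succ_top (by omega)]
  push_cast
  rfl

lemma harmonicSq_nonneg (n : ℕ) : 0 ≤ harmonicSq n :=
  Finset.sum_nonneg fun _ _ => by positivity

lemma harmonicSq_le (n : ℕ) : harmonicSq n ≤ n := by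
  induction n with
  | zero => simp [harmonicSq]
  | succ n ih =>
    rw [harmonicSq_succ]
    have : 1 / ((n : ℝ) + 1) ^ 2 ≤ 1 := by
      rw [div_le_one (by positivity)]
      nlinarith [(Nat.cast_nonneg n : (0 : ℝ) ≤ n)]
    push_cast
    linarith

lemma hasDerivAt_weightedSum (a : ℕ → ℝ) (N : ℕ) (t : ℝ) :
    HasDerivAt (weightedSum a N) (weightedSumDeriv a N t) t := by
  refine HasDerivAt.fun_sum fun n _ => ?_
  refine (((hasDerivAt_sin t).fun_pow (2 * (n + 1))).const_mul
    (a n * arcsinCoeff (n + 1))).congr_deriv ?_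
  rw [show 2 * (n + 1) - 1 = 2 * n + 1 by omega]
  push_cast
  ring

lemma hasDerivAt_weightedSumDeriv (a : ℕ → ℝ) (N : ℕ) (t : ℝ) :
    HasDerivAt (weightedSumDeriv a N)
      (∑ n ∈ Finset.range N,
        a n * (wallis n * sin t ^ (2 * n) - wallis (n + 1) * sin t ^ (2 * (n + 1)))) t := by
  refine HasDerivAt.fun_sum fun n _ => ?_
  refine ((((((hasDerivAt_sin t).fun_pow (2 * n + 1)).const_mul (2 * ((n : ℝ) + 1))).fun_mul
    (hasDerivAt_cos t))).const_mul (a n * arcsinCoeff (n + 1))).congr_deriv ?_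
  rw [← arcsinCoeff_succ n, ← arcsinCoeff_succ' n, show 2 * n + 1 - 1 = 2 * n by omega]
  have hc : cos t * cos t = 1 - sin t ^ 2 := by rw [← sin_sq_add_cos_sq t]; ring
  push_cast
  linear_combination (a n * arcsinCoeff (n + 1) * (2 * ((n : ℝ) + 1)) * (2 * n + 1)
    * sin t ^ (2 * n)) * hc

lemma weightedSum_one_second_deriv (N : ℕ) (t : ℝ) :
    ∑ n ∈ Finset.range N,
      (1 : ℝ) * (wallis n * sin t ^ (2 * n) - wallis (n + 1) * sin t ^ (2 * (n + 1)))
      = 4 - wallis N * sin t ^ (2 * N) := by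
  simp only [one_mul]
  rw [Finset.sum_range_sub' (fun n => wallis n * sin t ^ (2 * n))]
  simp [wallis_zero]

lemma weightedSum_harmonicSq_second_deriv (N : ℕ) (t : ℝ) :
    ∑ n ∈ Finset.range N,
      harmonicSq n * (wallis n * sin t ^ (2 * n) - wallis (n + 1) * sin t ^ (2 * (n + 1)))
      = 4 * weightedSum (fun _ => 1) N t - harmonicSq N * (wallis N * sin t ^ (2 * N)) := by
  induction N with
  | zero => simp [weightedSum, harmonicSq]
  | succ N ih =>
    have h := arcsinCoeff_succ N
    have h0 : (N : ℝ) + 1 ≠ 0 := by positivity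
    rw [Finset.sum_range_succ, ih, harmonicSq_succ]
    simp only [weightedSum, Finset.sum_range_succ]
    rw [← h]
    field_simp
    ring

lemma abs_le_of_second_deriv_le {h h' h'' : ℝ → ℝ} {ε a : ℝ} (hε : 0 ≤ ε)
    (hh : ∀ t, HasDerivAt h (h' t) t) (hh' : ∀ t, HasDerivAt h' (h'' t) t)
    (h0 : h 0 = 0) (h0' : h' 0 = 0) (bound : ∀ t ∈ Icc 0 a, |h'' t| ≤ ε) :
    ∀ t ∈ Icc 0 a, |h t| ≤ ε * t ^ 2 := by
  have key : ∀ t ∈ Icc 0 a, |h' t| ≤ ε * t := by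
    intro t ht
    have := norm_image_sub_le_of_norm_deriv_le_segment' (f := h') (f' := h'') (a := 0) (b := a)
      (C := ε) (fun x _ => (hh' x).hasDerivWithinAt) (fun x hx => bound x ⟨hx.1, hx.2.le⟩) t ht
    simpa [h0'] using this
  intro t ht
  have := norm_image_sub_le_of_norm_deriv_le_segment' (f := h) (f' := h') (a := 0) (b := t)
    (C := ε * t) (fun x _ => (hh x).hasDerivWithinAt)
    (fun x hx => (key x ⟨hx.1, hx.2.le.trans ht.2⟩).trans
      (mul_le_mul_of_nonneg_left hx.2.le hε)) t ⟨ht.1, le_rfl⟩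
  rw [pow_two, ← mul_assoc]
  simpa [h0] using this

lemma sin_sq_le_half {t : ℝ} (ht : t ∈ Icc 0 (π / 4)) : sin t ^ 2 ≤ 1 / 2 := by
  have h1 : 0 ≤ cos (2 * t) :=
    cos_nonneg_of_mem_Icc ⟨by linarith [ht.1, pi_pos], by linarith [ht.2]⟩
  rw [cos_two_mul, cos_sq'] at h1
  linarith

lemma sin_pow_le {t : ℝ} (ht : t ∈ Icc 0 (π / 4)) (N : ℕ) :
    sin t ^ (2 * N) ≤ (1 / 2) ^ N := by
  rw [pow_mul]
  exact pow_le_pow_left₀ (sq_nonneg _) (sin_sq_le_half ht) N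

lemma abs_weightedSum_one_sub_le {t : ℝ} (ht : t ∈ Icc 0 (π / 4)) (N : ℕ) :
    |weightedSum (fun _ => 1) N t - 2 * t ^ 2| ≤ wallis N * (1 / 2) ^ N * t ^ 2 := by
  refine abs_le_of_second_deriv_le (h := fun t => weightedSum (fun _ => 1) N t - 2 * t ^ 2)
    (h' := fun t => weightedSumDeriv (fun _ => 1) N t - 4 * t)
    (h'' := fun t => (4 - wallis N * sin t ^ (2 * N)) - 4)
    (by have := wallis_pos N; positivity) ?_ ?_ ?_ ?_ ?_ t ht
  · intro t
    refine ((hasDerivAt_weightedSum _ N t).sub ((hasDerivAt_pow 2 t).const_mul 2)).congr_deriv ?_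
    push_cast
    ring
  · intro t
    rw [← weightedSum_one_second_deriv]
    refine ((hasDerivAt_weightedSumDeriv _ N t).sub
      ((hasDerivAt_id t).const_mul 4)).congr_deriv ?_
    simp
  · simp [weightedSum]
  · simp [weightedSumDeriv]
  · intro t ht
    have h1 := sin_pow_le ht N
    have h2 : 0 ≤ sin t ^ (2 * N) := by rw [pow_mul]; positivity
    rw [sub_sub_cancel_left, abs_neg, abs_of_nonneg (mul_nonneg (wallis_pos N).le h2)]
    exact mul_le_mul_of_nonneg_left h1 (wallis_pos N).le

lemma abs_weightedSum_harmonicSq_sub_le {t : ℝ} (ht : t ∈ Icc 0 (π / 4)) (N : ℕ) :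
    |weightedSum harmonicSq N t - 2 / 3 * t ^ 4|
      ≤ (4 + harmonicSq N) * wallis N * (1 / 2) ^ N * t ^ 2 := by
  have hw := wallis_pos N
  have hH := harmonicSq_nonneg N
  refine abs_le_of_second_deriv_le (h := fun t => weightedSum harmonicSq N t - 2 / 3 * t ^ 4)
    (h' := fun t => weightedSumDeriv harmonicSq N t - 2 / 3 * (4 * t ^ 3))
    (h'' := fun t => (4 * weightedSum (fun _ => 1) N t
      - harmonicSq N * (wallis N * sin t ^ (2 * N))) - 2 / 3 * (4 * (3 * t ^ 2)))
    (by positivity) ?_ ?_ ?_ ?_ ?_ t ht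
  · intro t
    exact (hasDerivAt_weightedSum _ N t).sub ((hasDerivAt_pow 4 t).const_mul (2 / 3))
  · intro t
    rw [← weightedSum_harmonicSq_second_deriv]
    exact (hasDerivAt_weightedSumDeriv _ N t).sub
      (((hasDerivAt_pow 3 t).const_mul 4).const_mul (2 / 3))
  · simp [weightedSum]
  · simp [weightedSumDeriv]
  · intro t ht
    have h1 := sin_pow_le ht N
    have h2 : 0 ≤ sin t ^ (2 * N) := by rw [pow_mul]; positivity
    have h3 := abs_weightedSum_one_sub_le ht N
    have h4 : t ^ 2 ≤ 1 := by
      have : t ≤ 1 := ht.2.trans (by linarith [pi_le_four])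
      nlinarith [ht.1]
    have h5 : wallis N * (1 / 2) ^ N * t ^ 2 ≤ wallis N * (1 / 2) ^ N :=
      mul_le_of_le_one_right (by positivity) h4
    have h6 : harmonicSq N * (wallis N * sin t ^ (2 * N))
        ≤ harmonicSq N * (wallis N * (1 / 2) ^ N) := by gcongr
    have h7 : 0 ≤ harmonicSq N * (wallis N * sin t ^ (2 * N)) := by positivity
    have h8 := abs_le.1 (h3.trans h5)
    rw [abs_le]
    constructor <;> nlinarith [h8.1, h8.2]

lemma tendsto_error :
    Tendsto (fun N => (4 + harmonicSq N) * wallis N * (1 / 2) ^ N) atTop (𝓝 0) := by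
  have h1 := tendsto_pow_const_div_const_pow_of_one_lt 1 (one_lt_two (α := ℝ))
  have h2 := tendsto_pow_const_div_const_pow_of_one_lt 2 (one_lt_two (α := ℝ))
  have h3 := (h1.const_mul 32).add (h2.const_mul 8)
  rw [mul_zero, mul_zero, add_zero] at h3
  refine squeeze_zero' (Eventually.of_forall fun N => ?_) ?_ h3
  · have hw := wallis_pos N
    have hH := harmonicSq_nonneg N
    positivity
  · filter_upwards [eventually_gt_atTop 0] with N hN
    have hw := wallis_le N hN
    have hw' := wallis_pos N
    have hH := harmonicSq_le N
    calc (4 + harmonicSq N) * wallis N * (1 / 2) ^ N ≤ (4 + N) * (8 * N) * (1 / 2) ^ N := by gcongr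
      _ = _ := by rw [one_div, inv_pow]; ring

/-- The function `t ^ 3 / sinc t`, which is `t ^ 4 / sin t` away from zero. -/
noncomputable def cubeDivSinc (t : ℝ) : ℝ := t ^ 3 / sinc t

lemma cubeDivSinc_of_pos {t : ℝ} (ht : 0 < t) : cubeDivSinc t = t ^ 4 / sin t := by
  rw [cubeDivSinc, sinc_of_ne_zero ht.ne', div_div_eq_mul_div]
  ring

lemma sin_pos_of_mem_Ioc {t : ℝ} (ht : t ∈ Ioc 0 (π / 4)) : 0 < sin t :=
  sin_pos_of_pos_of_lt_pi ht.1 (by linarith [ht.2, pi_pos])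

lemma sinc_pos_of_mem_Icc {t : ℝ} (ht : t ∈ Icc 0 (π / 4)) : 0 < sinc t := by
  rcases ht.1.eq_or_lt with rfl | h
  · simp
  · rw [sinc_of_ne_zero h.ne']
    exact div_pos (sin_pos_of_mem_Ioc ⟨h, ht.2⟩) h

lemma continuousOn_cubeDivSinc : ContinuousOn cubeDivSinc (Icc 0 (π / 4)) :=
  (continuous_pow 3).continuousOn.div continuous_sinc.continuousOn
    fun _ ht => (sinc_pos_of_mem_Icc ht).ne'

lemma intervalIntegrable_cubeDivSinc_mul {g : ℝ → ℝ} (hg : Continuous g) :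
    IntervalIntegrable (fun t => cubeDivSinc t * g t) volume 0 (π / 4) := by
  apply ContinuousOn.intervalIntegrable
  rw [uIcc_of_le (by positivity)]
  exact continuousOn_cubeDivSinc.mul hg.continuousOn

/-- The integral of `t ^ 4 * cot t` over `[0, π / 4]`. -/
noncomputable def cotIntegral : ℝ := ∫ t in (0 : ℝ)..π / 4, cubeDivSinc t * cos t

lemma sum_eq_integral (N : ℕ) :
    ∑ n ∈ Finset.range N, harmonicSq n * arcsinCoeff (n + 1) / ((n : ℝ) + 1) * (1 / 2) ^ (n + 1)
      = ∫ t in (0 : ℝ)..π / 4, ∑ n ∈ Finset.range N,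
        harmonicSq n * arcsinCoeff (n + 1) * (2 * sin t ^ (2 * n + 1) * cos t) := by
  have hd : ∀ t ∈ uIcc 0 (π / 4), HasDerivAt (fun t => ∑ n ∈ Finset.range N,
      harmonicSq n * arcsinCoeff (n + 1) / ((n : ℝ) + 1) * sin t ^ (2 * (n + 1)))
      (∑ n ∈ Finset.range N,
        harmonicSq n * arcsinCoeff (n + 1) * (2 * sin t ^ (2 * n + 1) * cos t)) t := by
    intro t _
    refine HasDerivAt.fun_sum fun n _ => ?_
    refine (((hasDerivAt_sin t).fun_pow (2 * (n + 1))).const_mul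
      (harmonicSq n * arcsinCoeff (n + 1) / ((n : ℝ) + 1))).congr_deriv ?_
    have : (n : ℝ) + 1 ≠ 0 := by positivity
    rw [show 2 * (n + 1) - 1 = 2 * n + 1 by omega]
    push_cast
    field_simp
  rw [intervalIntegral.integral_eq_sub_of_hasDerivAt hd
    (Continuous.intervalIntegrable (by fun_prop) _ _)]
  have hs : sin (π / 4) ^ 2 = 1 / 2 := by
    rw [sin_pi_div_four, div_pow, sq_sqrt (by norm_num)]
    norm_num
  simp only [pow_mul, hs]
  simp

lemma tendsto_sum_cotIntegral :
    Tendsto (fun N => ∑ n ∈ Finset.range N,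
      harmonicSq n * arcsinCoeff (n + 1) / ((n : ℝ) + 1) * (1 / 2) ^ (n + 1))
      atTop (𝓝 (4 / 3 * cotIntegral)) := by
  rw [tendsto_iff_norm_sub_tendsto_zero]
  have h0 := (tendsto_error.const_mul 4).mul_const |π / 4 - 0|
  rw [mul_zero, zero_mul] at h0
  refine squeeze_zero (fun _ => norm_nonneg _) (fun N => ?_) h0
  rw [sum_eq_integral, cotIntegral, ← intervalIntegral.integral_const_mul,
    ← intervalIntegral.integral_sub (Continuous.intervalIntegrable (by fun_prop) _ _)
      ((intervalIntegrable_cubeDivSinc_mul continuous_cos).const_mul _)]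
  refine intervalIntegral.norm_integral_le_of_norm_le_const fun t ht => ?_
  rw [uIoc_of_le (by positivity)] at ht
  have hsin := sin_pos_of_mem_Ioc ht
  have hb := abs_weightedSum_harmonicSq_sub_le ⟨ht.1.le, ht.2⟩ N
  have he : ∑ n ∈ Finset.range N,
        harmonicSq n * arcsinCoeff (n + 1) * (2 * sin t ^ (2 * n + 1) * cos t)
        - 4 / 3 * (cubeDivSinc t * cos t)
      = (weightedSum harmonicSq N t - 2 / 3 * t ^ 4) * (2 * cos t / sin t) := by
    rw [cubeDivSinc_of_pos ht.1, weightedSum, sub_mul, Finset.sum_mul]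
    congr 1
    · refine Finset.sum_congr rfl fun n _ => ?_
      field_simp
      ring
    · ring
  rw [he, norm_mul, norm_eq_abs, norm_eq_abs]
  have hlow : t / 2 ≤ sin t := by
    refine le_trans ?_ (mul_le_sin ht.1.le (by linarith [ht.2, pi_pos]))
    have : 1 / 2 ≤ 2 / π := by
      rw [div_le_div_iff₀ two_pos pi_pos]
      linarith [pi_le_four]
    nlinarith [ht.1]
  have ht1 : t ≤ 1 := ht.2.trans (by linarith [pi_le_four])
  have hw := wallis_pos N
  have hH := harmonicSq_nonneg N
  have hcot : t ^ 2 * |2 * cos t / sin t| ≤ 4 := by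
    rw [abs_div, abs_of_pos hsin, abs_mul, abs_two, mul_div_assoc', div_le_iff₀ hsin]
    have := abs_cos_le_one t
    have h2 : t ^ 2 * (2 * |cos t|) ≤ t ^ 2 * (2 * 1) := by gcongr
    nlinarith [ht.1]
  calc _ ≤ (4 + harmonicSq N) * wallis N * (1 / 2) ^ N * t ^ 2 * |2 * cos t / sin t| := by gcongr
    _ = (4 + harmonicSq N) * wallis N * (1 / 2) ^ N * (t ^ 2 * |2 * cos t / sin t|) := by ring
    _ ≤ (4 + harmonicSq N) * wallis N * (1 / 2) ^ N * 4 := by gcongr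
    _ = _ := by ring

lemma tsum_eq_cotIntegral :
    ∑' n : ℕ, (∑ k ∈ Finset.Icc 1 (n + 1), (1 : ℝ) / (k : ℝ) ^ 2) / ((n + 2 : ℕ) : ℝ) ^ 3
        * 2 ^ (n + 2) / (Nat.choose (2 * (n + 2)) (n + 2) : ℝ) = 4 / 3 * cotIntegral := by
  have hs := (hasSum_iff_tendsto_nat_of_nonneg (fun n => ?_) _).2 tendsto_sum_cotIntegral
  · rw [← hasSum_nat_add_iff' 1] at hs
    simp only [Finset.sum_range_one, harmonicSq, zero_lt_one, Finset.Icc_eq_empty_of_lt,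
      Finset.sum_empty, zero_mul, zero_div, sub_zero] at hs
    rw [← hs.tsum_eq]
    refine tsum_congr fun n => ?_
    have h0 : ((n + 2).centralBinom : ℝ) ≠ 0 := by exact_mod_cast (n + 2).centralBinom_ne_zero
    have h1 : (n : ℝ) + 2 ≠ 0 := by positivity
    have h4 : (4 : ℝ) ^ (n + 2) = 2 ^ (n + 2) * 2 ^ (n + 2) := by rw [← mul_pow]; norm_num
    rw [← Nat.centralBinom, arcsinCoeff, wallis, one_div, inv_pow, pow_succ 4,
      show n + 1 + 1 = n + 2 from rfl, h4]
    push_cast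
    rw [show (n : ℝ) + 1 + 1 = n + 2 by ring]
    field_simp
  · have hw := wallis_pos (n + 1)
    have hH := harmonicSq_nonneg n
    unfold arcsinCoeff
    positivity

lemma cubeDivSinc_mul_cos (K : ℕ) {t : ℝ} (ht : t ∈ Icc 0 (π / 4)) :
    2 * ∑ k ∈ Finset.range K, t ^ 4 * sin (2 * ((k : ℝ) + 1) * t)
      = cubeDivSinc t * cos t - cubeDivSinc t * cos ((2 * K + 1) * t) := by
  induction K with
  | zero => simp
  | succ K ih =>
    rw [Finset.sum_range_succ, mul_add, ih]
    rcases ht.1.eq_or_lt with rfl | h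
    · simp [cubeDivSinc]
    · have hsin := sin_pos_of_mem_Ioc ⟨h, ht.2⟩
      rw [cubeDivSinc_of_pos h]
      have e1 : (2 * (K : ℝ) + 1) * t = 2 * (K + 1) * t - t := by ring
      have e2 : (2 * ((K + 1 : ℕ) : ℝ) + 1) * t = 2 * (K + 1) * t + t := by push_cast; ring
      rw [e1, e2, cos_sub, cos_add]
      field_simp
      ring

open FourierTransform in
lemma tendsto_integral_mul_cos {g : ℝ → ℝ} {a b : ℝ} (hab : a ≤ b)
    (hg : IntervalIntegrable g volume a b) :
    Tendsto (fun w : ℝ => ∫ t in a..b, g t * cos (w * t)) atTop (𝓝 0) := by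
  have h := Real.tendsto_integral_exp_smul_cocompact ((Ioc a b).indicator fun t => (g t : ℂ))
  have hw : Tendsto (fun w : ℝ => w / (2 * π)) atTop (cocompact ℝ) :=
    (tendsto_id.atTop_div_const (by positivity)).mono_right atTop_le_cocompact
  have h2 := (Complex.continuous_re.tendsto 0).comp (h.comp hw)
  rw [Complex.zero_re] at h2
  refine h2.congr fun w => ?_
  have hint : Integrable ((Ioc a b).indicator fun t => (g t : ℂ)) :=
    (integrable_indicator_iff measurableSet_Ioc).2 hg.1.ofReal
  have hint2 := (Real.fourierIntegral_convergent_iff (μ := volume) (w / (2 * π))).2 hint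
  have hint3 : Integrable (fun v : ℝ => 𝐞 (-(v * (w / (2 * π)))) •
      (Ioc a b).indicator (fun t => (g t : ℂ)) v) := by simpa [mul_comm] using hint2
  simp only [Function.comp]
  rw [← Complex.reCLM_apply, ← Complex.reCLM.integral_comp_comm hint3,
    intervalIntegral.integral_of_le hab, ← integral_indicator measurableSet_Ioc]
  congr 1
  funext v
  by_cases hv : v ∈ Ioc a b
  · have e : 2 * π * -(v * (w / (2 * π))) = -(w * v) := by
      field_simp
    simp only [hv, indicator_of_mem, Circle.smul_def, fourierChar_apply, e, smul_eq_mul,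
      Complex.reCLM_apply, Complex.re_mul_ofReal, Complex.exp_ofReal_mul_I_re, cos_neg]
    ring
  · simp [hv]

lemma tendsto_sum_integral_cotIntegral :
    Tendsto (fun K : ℕ => 2 * ∑ k ∈ Finset.range K,
      ∫ t in (0 : ℝ)..π / 4, t ^ 4 * sin (2 * ((k : ℝ) + 1) * t)) atTop (𝓝 cotIntegral) := by
  have hcub : IntervalIntegrable cubeDivSinc volume 0 (π / 4) := by
    simpa using intervalIntegrable_cubeDivSinc_mul (continuous_const (y := (1 : ℝ)))
  have hw : Tendsto (fun K : ℕ => 2 * (K : ℝ) + 1) atTop atTop :=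
    tendsto_atTop_add_const_right _ _ (tendsto_natCast_atTop_atTop.const_mul_atTop two_pos)
  have h := ((tendsto_integral_mul_cos (by positivity) hcub).comp hw).const_sub cotIntegral
  rw [sub_zero] at h
  refine h.congr fun K => ?_
  simp only [Function.comp]
  rw [cotIntegral, ← intervalIntegral.integral_sub
    (intervalIntegrable_cubeDivSinc_mul continuous_cos)
    (intervalIntegrable_cubeDivSinc_mul (by fun_prop)),
    ← intervalIntegral.integral_finsetSum
      (fun k _ => Continuous.intervalIntegrable (by fun_prop) _ _),
    ← intervalIntegral.integral_const_mul]
  refine intervalIntegral.integral_congr fun t ht => ?_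
  rw [uIcc_of_le (by positivity)] at ht
  exact (cubeDivSinc_mul_cos K ht).symm

lemma integral_pow_four_mul_sin {x : ℝ} (hx : x ≠ 0) (b : ℝ) :
    ∫ t in (0 : ℝ)..b, t ^ 4 * sin (x * t)
      = -(b ^ 4 * cos (x * b)) / x + 4 * b ^ 3 * sin (x * b) / x ^ 2
        + 12 * b ^ 2 * cos (x * b) / x ^ 3 - 24 * b * sin (x * b) / x ^ 4
        + 24 * (1 - cos (x * b)) / x ^ 5 := by
  have hd : ∀ t ∈ uIcc 0 b, HasDerivAt (fun t =>
      (-t ^ 4 / x + 12 * t ^ 2 / x ^ 3 - 24 / x ^ 5) * cos (x * t)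
        + (4 * t ^ 3 / x ^ 2 - 24 * t / x ^ 4) * sin (x * t)) (t ^ 4 * sin (x * t)) t := by
    intro t _
    have hl : HasDerivAt (fun t => x * t) x t := by simpa using (hasDerivAt_id t).const_mul x
    have hp : HasDerivAt (fun t => -t ^ 4 / x + 12 * t ^ 2 / x ^ 3 - 24 / x ^ 5)
        (-(4 * t ^ 3) / x + 12 * (2 * t) / x ^ 3) t := by
      simpa using ((((hasDerivAt_pow 4 t).fun_neg.div_const x).fun_add
        (((hasDerivAt_pow 2 t).const_mul 12).div_const (x ^ 3))).sub_const (24 / x ^ 5))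
    have hq : HasDerivAt (fun t => 4 * t ^ 3 / x ^ 2 - 24 * t / x ^ 4)
        (4 * (3 * t ^ 2) / x ^ 2 - 24 / x ^ 4) t := by
      simpa using (((hasDerivAt_pow 3 t).const_mul 4).div_const (x ^ 2)).fun_sub
        (((hasDerivAt_id t).const_mul 24).div_const (x ^ 4))
    refine ((hp.fun_mul hl.cos).fun_add (hq.fun_mul hl.sin)).congr_deriv ?_
    field_simp
    ring
  rw [intervalIntegral.integral_eq_sub_of_hasDerivAt hd
    (Continuous.intervalIntegrable (by fun_prop) _ _)]
  simp
  ring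

lemma integral_odd (m : ℕ) :
    ∫ t in (0 : ℝ)..π / 4, t ^ 4 * sin (2 * (((2 * m : ℕ) : ℝ) + 1) * t)
      = (π / 4) ^ 3 * ((-1) ^ m / (2 * (m : ℝ) + 1) ^ 2)
        - 3 / 2 * (π / 4) * ((-1) ^ m / (2 * (m : ℝ) + 1) ^ 4)
        + 3 / 4 * (1 / (2 * (m : ℝ) + 1) ^ 5) := by
  have hx : 2 * (m : ℝ) + 1 ≠ 0 := by positivity
  have e : 2 * (((2 * m : ℕ) : ℝ) + 1) * (π / 4) = π / 2 + m * π := by push_cast; ring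
  rw [integral_pow_four_mul_sin (by positivity), e, cos_add_nat_mul_pi, sin_add_nat_mul_pi,
    cos_pi_div_two, sin_pi_div_two]
  push_cast
  field_simp
  ring

lemma integral_even (m : ℕ) :
    ∫ t in (0 : ℝ)..π / 4, t ^ 4 * sin (2 * (((2 * m + 1 : ℕ) : ℝ) + 1) * t)
      = (π / 4) ^ 4 / 4 * ((-1) ^ m / ((m : ℝ) + 1))
        - 3 / 16 * (π / 4) ^ 2 * ((-1) ^ m / ((m : ℝ) + 1) ^ 3)
        + 3 / 128 * ((-1) ^ m / ((m : ℝ) + 1) ^ 5) + 3 / 128 * (1 / ((m : ℝ) + 1) ^ 5) := by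
  have hx : (m : ℝ) + 1 ≠ 0 := by positivity
  have e : 2 * (((2 * m + 1 : ℕ) : ℝ) + 1) * (π / 4) = (m + 1 : ℕ) * π := by push_cast; ring
  rw [integral_pow_four_mul_sin (by positivity), e, cos_nat_mul_pi, sin_nat_mul_pi]
  push_cast
  rw [show 2 * (2 * (m : ℝ) + 1 + 1) = 4 * (m + 1) by ring]
  field_simp
  ring

lemma sum_range_two_mul (f : ℕ → ℝ) (M : ℕ) :
    ∑ k ∈ Finset.range (2 * M), f k
      = ∑ m ∈ Finset.range M, f (2 * m) + ∑ m ∈ Finset.range M, f (2 * m + 1) := by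
  induction M with
  | zero => simp
  | succ M ih =>
    rw [show 2 * (M + 1) = 2 * M + 1 + 1 by ring, Finset.sum_range_succ, Finset.sum_range_succ, ih,
      Finset.sum_range_succ, Finset.sum_range_succ]
    ring

/-- The zeta series over the reals. -/
noncomputable def zetaSum (s : ℕ) : ℝ := ∑' n : ℕ, 1 / ((n : ℝ) + 1) ^ s

lemma hasSum_zetaSum {s : ℕ} (hs : 1 < s) :
    HasSum (fun n : ℕ => 1 / ((n : ℝ) + 1) ^ s) (zetaSum s) := by
  have := (summable_nat_add_iff 1).2 (Real.summable_one_div_nat_pow.2 hs)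
  push_cast at this
  exact this.hasSum

lemma riemannZeta_eq_zetaSum {s : ℕ} (hs : 1 < s) : riemannZeta s = (zetaSum s : ℂ) := by
  rw [zeta_eq_tsum_one_div_nat_add_one_cpow (by simpa using hs), zetaSum, Complex.ofReal_tsum]
  refine tsum_congr fun n => ?_
  rw [Complex.cpow_natCast]
  push_cast
  rfl

lemma hasSum_odd {s : ℕ} (hs : 1 < s) :
    HasSum (fun n : ℕ => 1 / (2 * (n : ℝ) + 1) ^ s) (zetaSum s * (1 - 1 / 2 ^ s)) := by
  have h := hasSum_zetaSum hs
  have ho : Summable fun n : ℕ => 1 / (2 * (n : ℝ) + 1) ^ s := by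
    simpa [Function.comp_def] using
      h.summable.comp_injective (i := fun n => 2 * n) (mul_right_injective₀ two_ne_zero)
  have he : HasSum (fun n : ℕ => 1 / (((2 * n + 1 : ℕ) : ℝ) + 1) ^ s) (1 / 2 ^ s * zetaSum s) := by
    refine (h.mul_left (1 / 2 ^ s)).congr_fun fun n => ?_
    push_cast
    rw [show 2 * (n : ℝ) + 1 + 1 = 2 * (n + 1) by ring, mul_pow]
    field_simp
  have hsum := HasSum.even_add_odd (f := fun n : ℕ => 1 / ((n : ℝ) + 1) ^ s)
    (m := ∑' n : ℕ, 1 / (2 * (n : ℝ) + 1) ^ s) (by simpa using ho.hasSum) he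
  have := hsum.unique h
  convert ho.hasSum using 1
  linarith

lemma hasSum_alternating {s : ℕ} (hs : 1 < s) :
    HasSum (fun n : ℕ => (-1 : ℝ) ^ n / ((n : ℝ) + 1) ^ s) (zetaSum s * (1 - 2 / 2 ^ s)) := by
  have h := hasSum_zetaSum hs
  have h1 := HasSum.even_add_odd (f := fun n : ℕ => (-1 : ℝ) ^ n / ((n : ℝ) + 1) ^ s)
    (m := zetaSum s * (1 - 1 / 2 ^ s)) (m' := -(1 / 2 ^ s) * zetaSum s)
    (by simpa using hasSum_odd hs) ?_
  · convert h1 using 1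
    ring
  · refine (h.mul_left (-(1 / 2 ^ s))).congr_fun fun n => ?_
    push_cast
    rw [show 2 * (n : ℝ) + 1 + 1 = 2 * (n + 1) by ring, mul_pow, pow_succ, pow_mul]
    field_simp
    simp

lemma hasSum_beta {s : ℕ} (hs : 1 < s) :
    HasSum (fun n : ℕ => (-1 : ℝ) ^ n / (2 * (n : ℝ) + 1) ^ s)
      (∑' k : ℕ, (-1 : ℝ) ^ k / ((2 * k + 1 : ℕ) : ℝ) ^ s) := by
  push_cast
  refine (Summable.of_norm ?_).hasSum
  refine (hasSum_odd hs).summable.congr fun n => ?_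
  rw [norm_div, norm_pow, norm_neg, norm_one, one_pow, norm_pow, norm_of_nonneg (by positivity)]

lemma sum_alternating_eq (N : ℕ) :
    ∑ m ∈ Finset.range (2 * N), (-1 : ℝ) ^ m / ((m : ℝ) + 1)
      = (harmonic (2 * N) : ℝ) - harmonic N := by
  induction N with
  | zero => simp
  | succ N ih =>
    rw [show 2 * (N + 1) = 2 * N + 1 + 1 by ring, Finset.sum_range_succ, Finset.sum_range_succ, ih,
      harmonic_succ, harmonic_succ, harmonic_succ, pow_succ, pow_mul]
    push_cast
    rw [show 2 * (N : ℝ) + 1 + 1 = 2 * (N + 1) by ring]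
    field_simp
    ring

lemma tendsto_sum_alternating :
    Tendsto (fun N : ℕ => ∑ m ∈ Finset.range (2 * N), (-1 : ℝ) ^ m / ((m : ℝ) + 1)) atTop
      (𝓝 (log 2)) := by
  have h2 : Tendsto (fun N : ℕ => 2 * N) atTop atTop :=
    tendsto_id.const_mul_atTop' two_pos
  have h := ((tendsto_harmonic_sub_log.comp h2).sub tendsto_harmonic_sub_log).add_const (log 2)
  rw [sub_self, zero_add] at h
  refine h.congr' ?_
  filter_upwards [eventually_gt_atTop 0] with N hN
  have hN' : (N : ℝ) ≠ 0 := by exact_mod_cast hN.ne'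
  simp only [Function.comp]
  rw [sum_alternating_eq, Nat.cast_mul, Nat.cast_two, log_mul two_ne_zero hN']
  ring

lemma cotIntegral_eq :
    cotIntegral = 2 * ((π / 4) ^ 3 * catalanConst - 3 / 2 * (π / 4) * diriBeta4
      + 3 / 4 * (zetaSum 5 * (1 - 1 / 2 ^ 5)) + (π / 4) ^ 4 / 4 * log 2
      - 3 / 16 * (π / 4) ^ 2 * (zetaSum 3 * (1 - 2 / 2 ^ 3))
      + 3 / 128 * (zetaSum 5 * (1 - 2 / 2 ^ 5)) + 3 / 128 * zetaSum 5) := by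
  have h2 : Tendsto (fun N : ℕ => 2 * N) atTop atTop :=
    tendsto_id.const_mul_atTop' two_pos
  refine tendsto_nhds_unique ((tendsto_sum_integral_cotIntegral.comp h2).comp h2) ?_
  have hC := ((hasSum_beta (s := 2) (by norm_num)).tendsto_sum_nat.comp h2).const_mul ((π / 4) ^ 3)
  have hB := ((hasSum_beta (s := 4) (by norm_num)).tendsto_sum_nat.comp h2).const_mul
    (3 / 2 * (π / 4))
  have hO := ((hasSum_odd (s := 5) (by norm_num)).tendsto_sum_nat.comp h2).const_mul (3 / 4)
  have hL := tendsto_sum_alternating.const_mul ((π / 4) ^ 4 / 4)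
  have h3 := ((hasSum_alternating (s := 3) (by norm_num)).tendsto_sum_nat.comp h2).const_mul
    (3 / 16 * (π / 4) ^ 2)
  have h5 := ((hasSum_alternating (s := 5) (by norm_num)).tendsto_sum_nat.comp h2).const_mul
    (3 / 128)
  have hZ := ((hasSum_zetaSum (s := 5) (by norm_num)).tendsto_sum_nat.comp h2).const_mul (3 / 128)
  rw [catalanConst, diriBeta4]
  refine (((((((hC.sub hB).add hO).add hL).sub h3).add h5).add hZ).const_mul 2).congr fun N => ?_
  simp only [Function.comp]
  rw [sum_range_two_mul _ (2 * N)]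
  simp only [integral_odd, integral_even, Finset.sum_add_distrib, Finset.sum_sub_distrib,
    ← Finset.mul_sum]
  ring

end CentralBinomSeries

/-- `∑_{n=2}^∞ (H_{n−1}^{(2)}/n³)·2ⁿ·C(2n,n)⁻¹
= π³C/24 − πβ(4) − 3π²ζ(3)/128 + 527ζ(5)/256 + π⁴·log 2/384`. -/
theorem statement11 :
    ((∑' n : ℕ, (∑ k ∈ Finset.Icc 1 (n + 1), (1 : ℝ) / (k : ℝ) ^ 2) / ((n + 2 : ℕ) : ℝ) ^ 3
        * 2 ^ (n + 2) / (Nat.choose (2 * (n + 2)) (n + 2) : ℝ) : ℝ) : ℂ)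
      = (Real.pi : ℂ) ^ 3 * (catalanConst : ℂ) / 24 - (Real.pi : ℂ) * (diriBeta4 : ℂ)
        - 3 * (Real.pi : ℂ) ^ 2 * riemannZeta 3 / 128 + 527 * riemannZeta 5 / 256
        + (Real.pi : ℂ) ^ 4 * (Real.log 2 : ℂ) / 384 := by
  rw [CentralBinomSeries.tsum_eq_cotIntegral, CentralBinomSeries.cotIntegral_eq]
  have h3 := CentralBinomSeries.riemannZeta_eq_zetaSum (s := 3) (by norm_num)
  have h5 := CentralBinomSeries.riemannZeta_eq_zetaSum (s := 5) (by norm_num)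
  push_cast at h3 h5
  rw [h3, h5]
  push_cast
  ring
end

section
/- ∫₀¹ (log x · log(1−x) · log(1+x))/x dx = 2·Li₄(1/2) + (7/4)·ζ(3)·log 2 − 3π⁴/160 + log⁴2/12 − π²·log²2/12. -/
open Set Filter Topology

/-- The polylogarithm series `∑ qₙ xⁿ⁺¹/(n+1)^s` with coefficients `q`. -/
noncomputable def weightedPolylog (q : ℕ → ℝ) (s : ℕ) (x : ℝ) : ℝ :=
  ∑' n : ℕ, q n * (x ^ (n + 1) / ((n + 1 : ℕ) : ℝ) ^ s)

lemma rpolylog_eq_weightedPolylog (s : ℕ) : rpolylog s = weightedPolylog (fun _ => 1) s := by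
  ext x; simp [rpolylog, weightedPolylog]

lemma weightedPolylog_zero (q : ℕ → ℝ) (s : ℕ) : weightedPolylog q s 0 = 0 := by
  simp [weightedPolylog]

lemma norm_weightedPolylog_term_le {q : ℕ → ℝ} (hq : ∀ n, |q n| ≤ 1) (s : ℕ) (x : ℝ) (n : ℕ) :
    ‖q n * (x ^ (n + 1) / ((n + 1 : ℕ) : ℝ) ^ s)‖ ≤ |x| ^ (n + 1) / ((n + 1 : ℕ) : ℝ) ^ s := by
  rw [Real.norm_eq_abs, abs_mul, abs_div, abs_pow, abs_pow, Nat.abs_cast]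
  exact mul_le_of_le_one_left (by positivity) (hq n)

lemma summable_pow_div_of_abs_lt_one (s : ℕ) {x : ℝ} (hx : |x| < 1) :
    Summable fun n : ℕ => |x| ^ (n + 1) / ((n + 1 : ℕ) : ℝ) ^ s := by
  refine Summable.of_nonneg_of_le (fun n => by positivity) (fun n => ?_)
    ((summable_nat_add_iff 1).2 (summable_geometric_of_lt_one (abs_nonneg x) hx))
  exact div_le_self (by positivity) (one_le_pow₀ (by push_cast; linarith [n.cast_nonneg (α := ℝ)]))

lemma summable_weightedPolylog {q : ℕ → ℝ} (hq : ∀ n, |q n| ≤ 1) (s : ℕ) {x : ℝ} (hx : |x| < 1) :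
    Summable fun n : ℕ => q n * (x ^ (n + 1) / ((n + 1 : ℕ) : ℝ) ^ s) :=
  Summable.of_norm_bounded (summable_pow_div_of_abs_lt_one s hx)
    (norm_weightedPolylog_term_le hq s x)

lemma hasDerivAt_weightedPolylog {q : ℕ → ℝ} (hq : ∀ n, |q n| ≤ 1) (s : ℕ) {x : ℝ}
    (hx : |x| < 1) (hx0 : x ≠ 0) :
    HasDerivAt (weightedPolylog q (s + 1)) (weightedPolylog q s x / x) x := by
  obtain ⟨r, hr, hr1⟩ := exists_between hx
  have hr0 : 0 < r := (abs_nonneg x).trans_lt hr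
  have key := hasDerivAt_tsum_of_isPreconnected
    (g := fun (n : ℕ) (y : ℝ) => q n * (y ^ (n + 1) / ((n + 1 : ℕ) : ℝ) ^ (s + 1)))
    (g' := fun (n : ℕ) (y : ℝ) => q n * (y ^ n / ((n + 1 : ℕ) : ℝ) ^ s))
    (u := fun n => r ^ n) (t := Ioo (-r) r) (y₀ := 0) (y := x)
    (summable_geometric_of_lt_one hr0.le hr1) isOpen_Ioo isPreconnected_Ioo
    (fun n y _ => by
      have h := (((hasDerivAt_pow (n + 1) y).div_const (((n + 1 : ℕ) : ℝ) ^ (s + 1))).const_mul (q n))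
      refine h.congr_deriv ?_
      have : ((n + 1 : ℕ) : ℝ) ≠ 0 := by positivity
      rw [add_tsub_cancel_right]
      field_simp
      ring)
    (fun n y hy => by
      rw [Real.norm_eq_abs, abs_mul, abs_div, abs_pow, abs_pow, Nat.abs_cast]
      refine (mul_le_of_le_one_left (by positivity) (hq n)).trans ?_
      refine (div_le_self (by positivity)
        (one_le_pow₀ (by push_cast; linarith [n.cast_nonneg (α := ℝ)]))).trans ?_
      exact pow_le_pow_left₀ (abs_nonneg y) (abs_lt.2 hy).le n)
    ⟨by linarith, hr0⟩ (by simp) (abs_lt.1 hr)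
  convert! key using 1
  rw [weightedPolylog, ← tsum_div_const]
  refine tsum_congr fun n => ?_
  field_simp
  ring

lemma summable_one_div_succ_pow (s : ℕ) :
    Summable fun n : ℕ => 1 / ((n + 1 : ℕ) : ℝ) ^ (s + 2) :=
  (summable_nat_add_iff 1).2 (Real.summable_one_div_nat_pow.2 (by omega : 1 < s + 2))

lemma norm_weightedPolylog_term_le_of_mem_Icc {q : ℕ → ℝ} (hq : ∀ n, |q n| ≤ 1) (s : ℕ) (n : ℕ)
    (x : ℝ) (hx : x ∈ Icc (-1 : ℝ) 1) :
    ‖q n * (x ^ (n + 1) / ((n + 1 : ℕ) : ℝ) ^ s)‖ ≤ 1 / ((n + 1 : ℕ) : ℝ) ^ s := by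
  refine (norm_weightedPolylog_term_le hq s x n).trans ?_
  gcongr
  exact pow_le_one₀ (abs_nonneg x) (abs_le.2 hx)

lemma continuousOn_weightedPolylog {q : ℕ → ℝ} (hq : ∀ n, |q n| ≤ 1) (s : ℕ) :
    ContinuousOn (weightedPolylog q (s + 2)) (Icc (-1) 1) :=
  continuousOn_tsum (fun n => by fun_prop) (summable_one_div_succ_pow s)
    (norm_weightedPolylog_term_le_of_mem_Icc hq (s + 2))

lemma rpolylog_one {x : ℝ} (hx : |x| < 1) : rpolylog 1 x = -Real.log (1 - x) := by
  rw [← (Real.hasSum_pow_div_log_of_abs_lt_one hx).tsum_eq, rpolylog]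
  simp

lemma hasDerivAt_rpolylog (s : ℕ) {x : ℝ} (hx : |x| < 1) (hx0 : x ≠ 0) :
    HasDerivAt (rpolylog (s + 1)) (rpolylog s x / x) x := by
  simp only [rpolylog_eq_weightedPolylog]
  exact hasDerivAt_weightedPolylog (by simp) s hx hx0

lemma continuousOn_rpolylog (s : ℕ) : ContinuousOn (rpolylog (s + 2)) (Icc (-1) 1) := by
  simp only [rpolylog_eq_weightedPolylog]
  exact continuousOn_weightedPolylog (by simp) s

lemma rpolylog_zero (s : ℕ) : rpolylog s 0 = 0 := by
  rw [rpolylog_eq_weightedPolylog, weightedPolylog_zero]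

lemma rpolylog_one_right (s : ℕ) (hs : s ≠ 0) : rpolylog s 1 = ∑' n : ℕ, 1 / (n : ℝ) ^ s := by
  by_cases h : Summable fun n : ℕ => 1 / (n : ℝ) ^ s
  · rw [h.tsum_eq_zero_add]
    simp [rpolylog, hs]
  · rw [tsum_eq_zero_of_not_summable h, rpolylog]
    simp only [one_pow]
    exact tsum_eq_zero_of_not_summable
      fun h' => h ((summable_nat_add_iff (f := fun n : ℕ => 1 / (n : ℝ) ^ s) 1).1 h')

lemma rpolylog_two_one : rpolylog 2 1 = Real.pi ^ 2 / 6 := by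
  rw [rpolylog_one_right 2 two_ne_zero, hasSum_zeta_two.tsum_eq]

lemma rpolylog_four_one : rpolylog 4 1 = Real.pi ^ 4 / 90 := by
  rw [rpolylog_one_right 4 four_ne_zero, hasSum_zeta_four.tsum_eq]

lemma riemannZeta_three_eq_rpolylog : riemannZeta 3 = (rpolylog 3 1 : ℂ) := by
  rw [rpolylog_one_right 3 three_ne_zero]
  have := zeta_nat_eq_tsum_of_gt_one (k := 3) (by norm_num)
  push_cast at this ⊢
  exact this

lemma rpolylog_three_neg_one : rpolylog 3 (-1) = -(3 / 4) * rpolylog 3 1 := by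
  have hs : Summable fun n : ℕ => 1 / ((n + 1 : ℕ) : ℝ) ^ 3 := summable_one_div_succ_pow 1
  have hodd : Summable fun k : ℕ => 1 / ((2 * k + 1 : ℕ) : ℝ) ^ 3 :=
    by simpa only [Function.comp_def] using
      hs.comp_injective (i := fun k : ℕ => 2 * k) (fun a b h => by simpa using h)
  have heven : Summable fun k : ℕ => 1 / ((2 * k + 1 + 1 : ℕ) : ℝ) ^ 3 :=
    by simpa only [Function.comp_def] using
      hs.comp_injective (i := fun k : ℕ => 2 * k + 1) (fun a b h => by simpa using h)
  have h1 : rpolylog 3 1 = ∑' k : ℕ, 1 / ((2 * k + 1 : ℕ) : ℝ) ^ 3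
      + ∑' k : ℕ, 1 / ((2 * k + 1 + 1 : ℕ) : ℝ) ^ 3 := by
    rw [rpolylog]
    simp only [one_pow]
    exact (tsum_even_add_odd (f := fun n : ℕ => 1 / ((n + 1 : ℕ) : ℝ) ^ 3) hodd heven).symm
  have h2 : rpolylog 3 (-1) = -∑' k : ℕ, 1 / ((2 * k + 1 : ℕ) : ℝ) ^ 3
      + ∑' k : ℕ, 1 / ((2 * k + 1 + 1 : ℕ) : ℝ) ^ 3 := by
    have e1 : ∀ k : ℕ, (-1 : ℝ) ^ (2 * k + 1) / ((2 * k + 1 : ℕ) : ℝ) ^ 3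
        = -(1 / ((2 * k + 1 : ℕ) : ℝ) ^ 3) := fun k => by
      rw [pow_succ, pow_mul]; simp; ring
    have e2 : ∀ k : ℕ, (-1 : ℝ) ^ (2 * k + 1 + 1) / ((2 * k + 1 + 1 : ℕ) : ℝ) ^ 3
        = 1 / ((2 * k + 1 + 1 : ℕ) : ℝ) ^ 3 := fun k => by
      rw [pow_succ, pow_succ, pow_mul]; simp
    rw [rpolylog, ← tsum_even_add_odd (f := fun n : ℕ => (-1 : ℝ) ^ (n + 1) / ((n + 1 : ℕ) : ℝ) ^ 3),
      ← tsum_neg]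
    · simp only [e1, e2]
    · simpa only [e1] using hodd.neg
    · simpa only [e2] using heven
  have h3 : ∑' k : ℕ, 1 / ((2 * k + 1 + 1 : ℕ) : ℝ) ^ 3 = 1 / 8 * rpolylog 3 1 := by
    rw [rpolylog, ← tsum_mul_left]
    refine tsum_congr fun k => ?_
    have : (k : ℝ) + 1 ≠ 0 := by positivity
    push_cast
    rw [show (2 * (k : ℝ) + 1 + 1) = 2 * (k + 1) by ring]
    field_simp
    norm_num
  linarith

/-- The coefficient of `xⁿ⁺¹` in `log (1 - x) ^ 2`. -/
noncomputable def logSqCoeff (n : ℕ) : ℝ :=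
  ∑ kl ∈ Finset.HasAntidiagonal.antidiagonal n, 1 / (kl.1 : ℝ) * (1 / ((kl.2 + 1 : ℕ) : ℝ))

lemma logSqCoeff_nonneg (n : ℕ) : 0 ≤ logSqCoeff n :=
  Finset.sum_nonneg fun _ _ => by positivity

lemma logSqCoeff_le_one (n : ℕ) : logSqCoeff n ≤ 1 := by
  rw [logSqCoeff, Finset.Nat.sum_antidiagonal_eq_sum_range_succ_mk, Finset.sum_range_succ']
  simp only [Nat.cast_zero, div_zero, zero_mul, add_zero]
  have h : ∀ i ∈ Finset.range n,
      1 / ((i + 1 : ℕ) : ℝ) * (1 / ((n - (i + 1) + 1 : ℕ) : ℝ)) ≤ 1 / n := by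
    intro i hi
    obtain ⟨j, rfl⟩ := Nat.exists_eq_add_of_lt (Finset.mem_range.1 hi)
    rw [show i + j + 1 - (i + 1) + 1 = j + 1 by omega, one_div_mul_one_div]
    refine one_div_le_one_div_of_le (by positivity) ?_
    push_cast
    nlinarith [i.cast_nonneg (α := ℝ), j.cast_nonneg (α := ℝ),
      mul_nonneg (i.cast_nonneg (α := ℝ)) (j.cast_nonneg (α := ℝ))]
  refine (Finset.sum_le_sum h).trans ?_
  rw [Finset.sum_const, Finset.card_range, nsmul_eq_mul]
  rw [mul_one_div]
  exact div_self_le_one _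

lemma abs_logSqCoeff_le_one (n : ℕ) : |logSqCoeff n| ≤ 1 := by
  rw [abs_of_nonneg (logSqCoeff_nonneg n)]
  exact logSqCoeff_le_one n

lemma weightedPolylog_logSqCoeff_zero {x : ℝ} (hx : |x| < 1) :
    weightedPolylog logSqCoeff 0 x = Real.log (1 - x) ^ 2 := by
  have hs : Summable fun n : ℕ => ‖x ^ (n + 1) / ((n + 1 : ℕ) : ℝ)‖ := by
    simpa only [norm_div, norm_pow, Real.norm_eq_abs, Nat.abs_cast, pow_one] using
      summable_pow_div_of_abs_lt_one 1 hx
  have hs' : Summable fun n : ℕ => ‖x ^ n / (n : ℝ)‖ := (summable_nat_add_iff 1).1 hs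
  have hl : ∑' n : ℕ, x ^ (n + 1) / ((n + 1 : ℕ) : ℝ) = -Real.log (1 - x) := by
    rw [← rpolylog_one hx, rpolylog]; simp
  have hl' : ∑' n : ℕ, x ^ n / (n : ℝ) = -Real.log (1 - x) := by
    rw [hs'.of_norm.tsum_eq_zero_add, hl]; simp
  have h := tsum_mul_tsum_eq_tsum_sum_antidiagonal_of_summable_norm hs' hs
  rw [hl, hl'] at h
  rw [sq, ← neg_mul_neg, h, weightedPolylog]
  refine tsum_congr fun n => ?_
  rw [logSqCoeff, Finset.sum_mul]
  refine Finset.sum_congr rfl fun kl hkl => ?_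
  rw [← Finset.HasAntidiagonal.mem_antidiagonal.1 hkl]
  simp only [pow_zero, div_one, pow_add, pow_one]
  ring

lemma summable_one_div_sq_mul_one_div_sq :
    Summable fun p : ℕ × ℕ => 1 / (p.1 : ℝ) ^ 2 * (1 / (p.2 : ℝ) ^ 2) :=
  hasSum_zeta_two.summable.mul_of_nonneg hasSum_zeta_two.summable
    (fun _ => by positivity) (fun _ => by positivity)

lemma injective_fst_add_succ :
    Function.Injective fun p : ℕ × ℕ => (p.1, p.1 + p.2 + 1) := by
  rintro ⟨a, b⟩ ⟨c, d⟩ h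
  simp only [Prod.mk.injEq] at h ⊢
  omega

lemma injective_add_succ_snd :
    Function.Injective fun p : ℕ × ℕ => (p.1 + p.2 + 1, p.2 + 1) := by
  rintro ⟨a, b⟩ ⟨c, d⟩ h
  simp only [Prod.mk.injEq] at h ⊢
  omega

lemma tsum_one_div_sq_sq_split :
    ∑' p : ℕ × ℕ, 1 / (p.1 : ℝ) ^ 2 * (1 / ((p.1 + p.2 + 1 : ℕ) : ℝ) ^ 2)
      + ∑' p : ℕ × ℕ, 1 / ((p.1 + p.2 + 1 : ℕ) : ℝ) ^ 2 * (1 / ((p.2 + 1 : ℕ) : ℝ) ^ 2)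
      = (Real.pi ^ 2 / 6) ^ 2 := by
  have hsum := summable_one_div_sq_mul_one_div_sq
  set f : ℕ × ℕ → ℝ := fun p => 1 / (p.1 : ℝ) ^ 2 * (1 / (p.2 : ℝ) ^ 2) with hf
  have htot : ∑' p, f p = (Real.pi ^ 2 / 6) ^ 2 := by
    rw [sq, (hasSum_zeta_two.mul hasSum_zeta_two hsum).tsum_eq]
  have h1 : ∑' p : ℕ × ℕ, f (p.1, p.1 + p.2 + 1) = ∑' p, {p : ℕ × ℕ | p.1 < p.2}.indicator f p := by
    rw [← injective_fst_add_succ.tsum_eq (f := {p : ℕ × ℕ | p.1 < p.2}.indicator f)]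
    · refine tsum_congr fun p => ?_
      rw [indicator_of_mem]
      simp only [mem_ofPred_eq]
      omega
    · rintro ⟨a, b⟩ hp
      have h : (a, b) ∈ {p : ℕ × ℕ | p.1 < p.2} := Set.mem_of_indicator_ne_zero hp
      have : a < b := h
      exact ⟨(a, b - a - 1), Prod.ext rfl (by dsimp only; omega)⟩
  have h2 : ∑' p : ℕ × ℕ, f (p.1 + p.2 + 1, p.2 + 1)
      = ∑' p, {p : ℕ × ℕ | p.1 < p.2}ᶜ.indicator f p := by
    rw [← injective_add_succ_snd.tsum_eq (f := {p : ℕ × ℕ | p.1 < p.2}ᶜ.indicator f)]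
    · refine tsum_congr fun p => ?_
      rw [indicator_of_mem]
      simp only [mem_compl_iff, mem_ofPred_eq]
      omega
    · rintro ⟨a, b⟩ hp
      have h' : (a, b) ∈ {p : ℕ × ℕ | p.1 < p.2}ᶜ := Set.mem_of_indicator_ne_zero hp
      have h : ¬ a < b := h'
      have hb : b ≠ 0 := by
        rintro rfl
        exact hp (by simp [hf, indicator])
      exact ⟨(a - b, b - 1), by simp only [Prod.mk.injEq]; omega⟩
  change ∑' p : ℕ × ℕ, f (p.1, p.1 + p.2 + 1) + ∑' p : ℕ × ℕ, f (p.1 + p.2 + 1, p.2 + 1) = _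
  rw [h1, h2, ← (hsum.indicator _).tsum_add (hsum.indicator _), ← htot]
  exact tsum_congr fun p => indicator_self_add_compl_apply _ f p

lemma hasSum_one_div_succ_sq : HasSum (fun n : ℕ => 1 / ((n + 1 : ℕ) : ℝ) ^ 2) (Real.pi ^ 2 / 6) := by
  rw [hasSum_nat_add_iff (f := fun n : ℕ => 1 / (n : ℝ) ^ 2) 1]
  simpa using hasSum_zeta_two

lemma hasSum_one_div_succ_pow_four : HasSum (fun n : ℕ => 1 / ((n + 1 : ℕ) : ℝ) ^ 4) (Real.pi ^ 4 / 90) := by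
  rw [hasSum_nat_add_iff (f := fun n : ℕ => 1 / (n : ℝ) ^ 4) 1]
  simpa using hasSum_zeta_four

lemma hasSum_tornheim :
    HasSum (fun p : ℕ × ℕ => 1 / (p.1 : ℝ) * (1 / ((p.2 + 1 : ℕ) : ℝ))
      * (1 / ((p.1 + p.2 + 1 : ℕ) : ℝ) ^ 2)) (Real.pi ^ 4 / 180) := by
  have hsum := summable_one_div_sq_mul_one_div_sq
  have s1 : Summable fun p : ℕ × ℕ => 1 / (p.1 : ℝ) ^ 2 * (1 / ((p.1 + p.2 + 1 : ℕ) : ℝ) ^ 2) :=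
    by simpa only [Function.comp_def] using hsum.comp_injective injective_fst_add_succ
  have s2 : Summable fun p : ℕ × ℕ =>
      1 / ((p.1 + p.2 + 1 : ℕ) : ℝ) ^ 2 * (1 / ((p.2 + 1 : ℕ) : ℝ) ^ 2) :=
    by simpa only [Function.comp_def] using hsum.comp_injective injective_add_succ_snd
  have p22 : Summable fun p : ℕ × ℕ => 1 / (p.1 : ℝ) ^ 2 * (1 / ((p.2 + 1 : ℕ) : ℝ) ^ 2) :=
    Summable.mul_of_nonneg (f := fun n : ℕ => 1 / (n : ℝ) ^ 2)
      (g := fun n : ℕ => 1 / ((n + 1 : ℕ) : ℝ) ^ 2) hasSum_zeta_two.summable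
      hasSum_one_div_succ_sq.summable (fun n => by dsimp only [Pi.zero_apply]; positivity)
      (fun n => by dsimp only [Pi.zero_apply]; positivity)
  have z22 : HasSum (fun p : ℕ × ℕ => 1 / (p.1 : ℝ) ^ 2 * (1 / ((p.2 + 1 : ℕ) : ℝ) ^ 2))
      (Real.pi ^ 2 / 6 * (Real.pi ^ 2 / 6)) :=
    HasSum.mul (f := fun n : ℕ => 1 / (n : ℝ) ^ 2)
      (g := fun n : ℕ => 1 / ((n + 1 : ℕ) : ℝ) ^ 2) hasSum_zeta_two hasSum_one_div_succ_sq p22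
  have hd : HasSum (fun n : ℕ => if n = 0 then (1 : ℝ) else 0) 1 := hasSum_ite_eq 0 1
  have p4 : Summable fun p : ℕ × ℕ =>
      (if p.1 = 0 then (1 : ℝ) else 0) * (1 / ((p.2 + 1 : ℕ) : ℝ) ^ 4) :=
    Summable.mul_of_nonneg (f := fun n : ℕ => if n = 0 then (1 : ℝ) else 0)
      (g := fun n : ℕ => 1 / ((n + 1 : ℕ) : ℝ) ^ 4) hd.summable
      hasSum_one_div_succ_pow_four.summable
      (fun n => by dsimp only [Pi.zero_apply]; split_ifs <;> norm_num)
      (fun n => by dsimp only [Pi.zero_apply]; positivity)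
  have d4 : HasSum (fun p : ℕ × ℕ => (if p.1 = 0 then (1 : ℝ) else 0)
      * (1 / ((p.2 + 1 : ℕ) : ℝ) ^ 4)) (1 * (Real.pi ^ 4 / 90)) :=
    HasSum.mul (f := fun n : ℕ => if n = 0 then (1 : ℝ) else 0)
      (g := fun n : ℕ => 1 / ((n + 1 : ℕ) : ℝ) ^ 4) hd hasSum_one_div_succ_pow_four p4
  have H := (((z22.add d4).sub s1.hasSum).sub s2.hasSum).div_const 2
  convert! H using 1
  · ext ⟨k, l⟩
    have hl : (l : ℝ) + 1 ≠ 0 := by positivity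
    have hkl : (k : ℝ) + l + 1 ≠ 0 := by positivity
    rcases eq_or_ne k 0 with rfl | hk
    · simp only [Nat.cast_zero, zero_add, if_true]
      push_cast
      field_simp
      ring
    · have hk' : (k : ℝ) ≠ 0 := Nat.cast_ne_zero.2 hk
      simp only [hk, if_false, zero_mul, add_zero]
      push_cast
      field_simp
      ring
  · linarith [tsum_one_div_sq_sq_split]

lemma weightedPolylog_logSqCoeff_two_one :
    weightedPolylog logSqCoeff 2 1 = Real.pi ^ 4 / 180 := by
  have h := (Finset.HasAntidiagonal.sigmaAntidiagonalEquivProd (A := ℕ)).hasSum_iff.2 hasSum_tornheim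
  have h' := h.sigma (fun n => hasSum_fintype _)
  rw [← h'.tsum_eq, weightedPolylog]
  refine tsum_congr fun n => ?_
  rw [logSqCoeff, Finset.sum_mul, ← Finset.sum_coe_sort]
  refine Finset.sum_congr rfl fun kl _ => ?_
  have hkl := Finset.HasAntidiagonal.mem_antidiagonal.1 kl.2
  simp [Finset.HasAntidiagonal.sigmaAntidiagonalEquivProd, ← hkl]

lemma continuous_log_mul_log_one_sub :
    Continuous fun x : ℝ => Real.log x * Real.log (1 - x) := by
  have h0 : ContinuousAt (fun x : ℝ => Real.log x * Real.log (1 - x)) 0 := by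
    have hd : DifferentiableAt ℝ (fun x : ℝ => Real.log (1 - x)) 0 :=
      DifferentiableAt.log (by fun_prop) (by norm_num)
    have hc := (Real.continuous_mul_log.continuousAt (x := 0)).mul
      (continuousAt_dslope_same.2 hd)
    refine hc.congr (Eventually.of_forall fun x => ?_)
    rcases eq_or_ne x 0 with rfl | hx
    · simp
    · simp only [Pi.mul_apply, dslope_of_ne _ hx, slope_def_field]
      field_simp
      simp
      ring
  refine continuous_iff_continuousAt.2 fun x => ?_
  rcases eq_or_ne x 0 with rfl | hx
  · exact h0
  rcases eq_or_ne x 1 with rfl | hx1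
  · have h1 : ContinuousAt (fun x : ℝ => Real.log (1 - x) * Real.log (1 - (1 - x))) 1 :=
      ContinuousAt.comp (g := fun x : ℝ => Real.log x * Real.log (1 - x)) (f := fun x => 1 - x)
        (by simpa using h0) (by fun_prop)
    refine h1.congr (Eventually.of_forall fun x => ?_)
    simp only [sub_sub_cancel]
    ring
  · exact (Real.continuousAt_log hx).mul
      (ContinuousAt.log (by fun_prop) (sub_ne_zero.2 hx1.symm))

lemma eq_of_hasDerivAt_zero {f : ℝ → ℝ} {a b : ℝ} (hc : ContinuousOn f (Icc a b))
    (hd : ∀ x ∈ Ioo a b, HasDerivAt f 0 x) {x : ℝ} (hx : x ∈ Icc a b) : f x = f b := by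
  rcases hx.2.eq_or_lt with rfl | hxb
  · rfl
  obtain ⟨c, -, hc'⟩ := exists_hasDerivAt_eq_slope f (fun _ => 0) hxb
    (hc.mono (Icc_subset_Icc_left hx.1)) fun y hy => hd y ⟨hx.1.trans_lt hy.1, hy.2⟩
  rw [eq_div_iff (sub_pos.2 hxb).ne', zero_mul] at hc'
  linarith

lemma abs_weightedPolylog_logSqCoeff_one_le {x : ℝ} (h0 : 0 ≤ x) (h1 : x < 1) :
    |weightedPolylog logSqCoeff 1 x| ≤ |Real.log (1 - x)| := by
  have hx : |x| < 1 := by rwa [abs_of_nonneg h0]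
  rw [← abs_neg (Real.log (1 - x)), ← rpolylog_one hx, rpolylog_eq_weightedPolylog]
  have hnn : ∀ q : ℕ → ℝ, (∀ n, 0 ≤ q n) → 0 ≤ weightedPolylog q 1 x := fun q hq =>
    tsum_nonneg fun n => mul_nonneg (hq n) (by positivity)
  rw [abs_of_nonneg (hnn _ logSqCoeff_nonneg), abs_of_nonneg (hnn _ fun _ => zero_le_one)]
  refine (summable_weightedPolylog abs_logSqCoeff_le_one 1 hx).tsum_le_tsum (fun n => ?_)
    (summable_weightedPolylog (by simp) 1 hx)
  exact mul_le_mul_of_nonneg_right (logSqCoeff_le_one n) (by positivity)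

/-- A primitive of `log x * log (1 - x) ^ 2 / x` on `[0, 1]`. -/
noncomputable def logLogSqPrimitive (x : ℝ) : ℝ :=
  Real.log x * weightedPolylog logSqCoeff 1 x - weightedPolylog logSqCoeff 2 x

lemma logLogSqPrimitive_zero : logLogSqPrimitive 0 = 0 := by
  simp [logLogSqPrimitive, weightedPolylog_zero]

lemma logLogSqPrimitive_one : logLogSqPrimitive 1 = -(Real.pi ^ 4 / 180) := by
  simp [logLogSqPrimitive, weightedPolylog_logSqCoeff_two_one]

lemma hasDerivAt_logLogSqPrimitive {x : ℝ} (hx : x ∈ Ioo (0 : ℝ) 1) :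
    HasDerivAt logLogSqPrimitive (Real.log x * Real.log (1 - x) ^ 2 / x) x := by
  have hx1 : |x| < 1 := by rw [abs_of_pos hx.1]; exact hx.2
  have hx0 := hx.1.ne'
  have h1 := hasDerivAt_weightedPolylog abs_logSqCoeff_le_one 0 hx1 hx0
  have h2 := hasDerivAt_weightedPolylog abs_logSqCoeff_le_one 1 hx1 hx0
  rw [weightedPolylog_logSqCoeff_zero hx1] at h1
  refine (((Real.hasDerivAt_log hx0).mul h1).sub h2).congr_deriv ?_
  field_simp
  ring

lemma continuousOn_logLogSqPrimitive : ContinuousOn logLogSqPrimitive (Icc 0 1) := by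
  have hQ : ContinuousOn (weightedPolylog logSqCoeff 2) (Icc 0 1) :=
    (continuousOn_weightedPolylog abs_logSqCoeff_le_one 0).mono
      (Icc_subset_Icc_left (by norm_num))
  refine ContinuousOn.sub (fun x hx => ?_) hQ
  have hbound : ∀ y ∈ Icc (0 : ℝ) 1, ‖Real.log y * weightedPolylog logSqCoeff 1 y‖
      ≤ ‖Real.log y * Real.log (1 - y)‖ := fun y hy => by
    rcases hy.2.eq_or_lt with rfl | hy1
    · simp
    · rw [norm_mul, norm_mul]
      exact mul_le_mul_of_nonneg_left (abs_weightedPolylog_logSqCoeff_one_le hy.1 hy1)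
        (norm_nonneg _)
  have hend : Real.log x * Real.log (1 - x) = 0 →
      ContinuousWithinAt (fun y => Real.log y * weightedPolylog logSqCoeff 1 y) (Icc 0 1) x := by
    intro hm
    have hv : Real.log x * weightedPolylog logSqCoeff 1 x = 0 := by
      have := hbound x hx
      rwa [hm, norm_zero, norm_le_zero_iff] at this
    rw [ContinuousWithinAt, hv]
    refine squeeze_zero_norm' (eventually_mem_nhdsWithin.mono hbound) ?_
    have := (continuous_log_mul_log_one_sub.norm.tendsto x).mono_left
      (nhdsWithin_le_nhds (s := Icc (0 : ℝ) 1))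
    simpa only [hm, norm_zero] using this
  rcases hx.1.eq_or_lt with rfl | hx0
  · exact hend (by simp)
  rcases hx.2.eq_or_lt with rfl | hx1
  · exact hend (by simp)
  · have hd := hasDerivAt_weightedPolylog abs_logSqCoeff_le_one 0 (x := x)
      (by rwa [abs_of_pos hx0]) hx0.ne'
    exact ((Real.continuousAt_log hx0.ne').mul hd.continuousAt).continuousWithinAt

lemma hasDerivAt_log_one_sub {x : ℝ} (hx : x < 1) :
    HasDerivAt (fun x : ℝ => Real.log (1 - x)) (-1 / (1 - x)) x :=
  ((hasDerivAt_id x).const_sub 1).log (sub_pos.2 hx).ne'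

lemma hasDerivAt_logLogSqPrimitive_one_sub {x : ℝ} (hx : x ∈ Ioo (0 : ℝ) 1) :
    HasDerivAt (fun x => logLogSqPrimitive (1 - x))
      (-(Real.log (1 - x) * Real.log x ^ 2 / (1 - x))) x := by
  have h := (hasDerivAt_logLogSqPrimitive (x := 1 - x)
    ⟨by linarith [hx.2], by linarith [hx.1]⟩).comp_const_sub 1 x
  simpa only [sub_sub_cancel] using h

lemma mapsTo_one_sub_Icc : MapsTo (fun x : ℝ => 1 - x) (Icc (1 / 2) 1) (Icc 0 1) :=
  fun x hx => ⟨by linarith [hx.2], by linarith [hx.1]⟩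

lemma Icc_half_one_subset : Icc (1 / 2 : ℝ) 1 ⊆ Icc 0 1 := Icc_subset_Icc_left (by norm_num)

lemma continuousOn_logLogSqPrimitive_one_sub :
    ContinuousOn (fun x => logLogSqPrimitive (1 - x)) (Icc (1 / 2) 1) :=
  continuousOn_logLogSqPrimitive.comp (by fun_prop) mapsTo_one_sub_Icc

lemma log_half : Real.log (1 / 2) = -Real.log 2 := by
  rw [one_div, Real.log_inv]

lemma logLogSqPrimitive_half :
    logLogSqPrimitive (1 / 2) = -(Real.pi ^ 4 / 360) + Real.log 2 ^ 4 / 4 := by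
  have h := eq_of_hasDerivAt_zero (a := 1 / 2) (b := 1) (x := 1 / 2)
    (f := fun x => logLogSqPrimitive x + logLogSqPrimitive (1 - x)
      - (Real.log x * Real.log (1 - x)) ^ 2 / 2)
    (((continuousOn_logLogSqPrimitive.mono Icc_half_one_subset).add
      continuousOn_logLogSqPrimitive_one_sub).sub
      ((continuous_log_mul_log_one_sub.continuousOn.pow 2).div_const 2))
    (fun x hx => by
      have hx' : x ∈ Ioo (0 : ℝ) 1 := ⟨by linarith [hx.1], hx.2⟩
      have hx0 := hx'.1.ne'
      have hx1 := (sub_pos.2 hx.2).ne'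
      refine (((hasDerivAt_logLogSqPrimitive hx').add
        (hasDerivAt_logLogSqPrimitive_one_sub hx')).sub
        ((((Real.hasDerivAt_log hx0).mul (hasDerivAt_log_one_sub hx.2)).pow 2).div_const
          2)).congr_deriv ?_
      simp only [Pi.mul_apply]
      field_simp
      ring)
    ⟨le_rfl, by norm_num⟩
  simp only [sub_self, logLogSqPrimitive_one, logLogSqPrimitive_zero, Real.log_one] at h
  rw [show (1 : ℝ) - 1 / 2 = 1 / 2 by norm_num, log_half] at h
  linear_combination h / 2

lemma hasDerivAt_rpolylog_two {x : ℝ} (hx : |x| < 1) (hx0 : x ≠ 0) :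
    HasDerivAt (rpolylog 2) (-Real.log (1 - x) / x) x := by
  rw [← rpolylog_one hx]
  exact hasDerivAt_rpolylog 1 hx hx0

lemma continuousOn_rpolylog_half_one (s : ℕ) :
    ContinuousOn (rpolylog (s + 2)) (Icc (1 / 2) 1) :=
  (continuousOn_rpolylog s).mono (Icc_subset_Icc_left (by norm_num))

lemma continuousOn_rpolylog_one_sub (s : ℕ) :
    ContinuousOn (fun x => rpolylog (s + 2) (1 - x)) (Icc (1 / 2) 1) :=
  (continuousOn_rpolylog s).comp (by fun_prop)
    fun x hx => ⟨by linarith [hx.2], by linarith [hx.1]⟩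

lemma one_sub_inv_mem_Icc {x : ℝ} (hx : x ∈ Icc (1 / 2 : ℝ) 1) : 1 - x⁻¹ ∈ Icc (-1 : ℝ) 1 := by
  have hx0 : 0 < x := by linarith [hx.1]
  have h2 : x⁻¹ ≤ 2 := by
    rw [inv_le_comm₀ hx0 two_pos]
    linarith [hx.1]
  exact ⟨by linarith, by linarith [inv_pos.2 hx0]⟩

lemma abs_one_sub_inv_lt_one {x : ℝ} (hx : x ∈ Ioo (1 / 2 : ℝ) 1) : |1 - x⁻¹| < 1 := by
  have hx0 : 0 < x := by linarith [hx.1]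
  have h2 : x⁻¹ < 2 := by
    rw [inv_lt_comm₀ hx0 two_pos]
    linarith [hx.1]
  exact abs_lt.2 ⟨by linarith, by linarith [inv_pos.2 hx0]⟩

lemma one_sub_inv_ne_zero {x : ℝ} (hx : x ∈ Ioo (1 / 2 : ℝ) 1) : 1 - x⁻¹ ≠ 0 := by
  intro h
  have : x = 1 := inv_eq_one.1 (by linarith)
  linarith [hx.2]

lemma continuousOn_rpolylog_one_sub_inv (s : ℕ) :
    ContinuousOn (fun x => rpolylog (s + 2) (1 - x⁻¹)) (Icc (1 / 2) 1) :=
  (continuousOn_rpolylog s).comp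
    (continuousOn_const.sub (continuousOn_inv₀.mono fun x hx => by
      have : 0 < x := by linarith [hx.1]
      exact this.ne'))
    fun x hx => one_sub_inv_mem_Icc hx

lemma continuousOn_log_half_one : ContinuousOn Real.log (Icc (1 / 2) 1) :=
  Real.continuousOn_log.mono fun x hx => by
    have : 0 < x := by linarith [hx.1]
    exact this.ne'

lemma hasDerivAt_one_sub_inv {x : ℝ} (hx : x ≠ 0) :
    HasDerivAt (fun x : ℝ => 1 - x⁻¹) (1 / x ^ 2) x := by
  refine ((hasDerivAt_inv hx).const_sub 1).congr_deriv ?_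
  field_simp

/-- Euler's reflection formula for the dilogarithm. -/
lemma rpolylog_two_reflection {x : ℝ} (hx : x ∈ Icc (1 / 2 : ℝ) 1) :
    rpolylog 2 x + rpolylog 2 (1 - x) + Real.log x * Real.log (1 - x) = Real.pi ^ 2 / 6 := by
  have h := eq_of_hasDerivAt_zero (a := 1 / 2) (b := 1) (x := x)
    (f := fun x => rpolylog 2 x + rpolylog 2 (1 - x) + Real.log x * Real.log (1 - x))
    (((continuousOn_rpolylog_half_one 0).add (continuousOn_rpolylog_one_sub 0)).add
      continuous_log_mul_log_one_sub.continuousOn)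
    (fun x hx => by
      have hx0 : 0 < x := by linarith [hx.1]
      have hx1 := sub_pos.2 hx.2
      refine (((hasDerivAt_rpolylog_two (abs_lt.2 ⟨by linarith, hx.2⟩) hx0.ne').add
        ((hasDerivAt_rpolylog_two (x := 1 - x) (abs_lt.2 ⟨by linarith, by linarith⟩)
          hx1.ne').comp_const_sub 1 x)).add
        ((Real.hasDerivAt_log hx0.ne').mul (hasDerivAt_log_one_sub hx.2))).congr_deriv ?_
      rw [sub_sub_cancel]
      field_simp
      ring) hx
  rw [h]
  simp [rpolylog_two_one, rpolylog_zero]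

/-- Landen's identity for the dilogarithm. -/
lemma rpolylog_two_landen {x : ℝ} (hx : x ∈ Icc (1 / 2 : ℝ) 1) :
    rpolylog 2 (1 - x⁻¹) + rpolylog 2 (1 - x) + Real.log x ^ 2 / 2 = 0 := by
  have h := eq_of_hasDerivAt_zero (a := 1 / 2) (b := 1) (x := x)
    (f := fun x => rpolylog 2 (1 - x⁻¹) + rpolylog 2 (1 - x) + Real.log x ^ 2 / 2)
    (((continuousOn_rpolylog_one_sub_inv 0).add (continuousOn_rpolylog_one_sub 0)).add
      ((continuousOn_log_half_one.pow 2).div_const 2))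
    (fun x hx => by
      have hx0 : 0 < x := by linarith [hx.1]
      have hx1 := sub_pos.2 hx.2
      have hx2 : x - 1 ≠ 0 := by linarith
      refine ((((hasDerivAt_rpolylog_two (abs_one_sub_inv_lt_one hx)
        (one_sub_inv_ne_zero hx)).comp x (hasDerivAt_one_sub_inv hx0.ne')).add
        ((hasDerivAt_rpolylog_two (x := 1 - x) (abs_lt.2 ⟨by linarith, by linarith⟩)
          hx1.ne').comp_const_sub 1 x)).add
        (((Real.hasDerivAt_log hx0.ne').pow 2).div_const 2)).congr_deriv ?_
      rw [sub_sub_cancel, sub_sub_cancel, Real.log_inv,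
        show 1 - x⁻¹ = (x - 1) / x by field_simp, show 1 - x = -(x - 1) by ring]
      field_simp
      ring) hx
  rw [h]
  simp [rpolylog_zero]

/-- Landen's identity for the trilogarithm. -/
lemma rpolylog_three_landen {x : ℝ} (hx : x ∈ Icc (1 / 2 : ℝ) 1) :
    rpolylog 3 x + rpolylog 3 (1 - x) + rpolylog 3 (1 - x⁻¹) - Real.log x ^ 3 / 6
      - Real.pi ^ 2 / 6 * Real.log x + (Real.log x * Real.log (1 - x)) * Real.log x / 2
      = rpolylog 3 1 := by
  have h := eq_of_hasDerivAt_zero (a := 1 / 2) (b := 1) (x := x)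
    (f := fun x => rpolylog 3 x + rpolylog 3 (1 - x) + rpolylog 3 (1 - x⁻¹) - Real.log x ^ 3 / 6
      - Real.pi ^ 2 / 6 * Real.log x + (Real.log x * Real.log (1 - x)) * Real.log x / 2)
    ((((((continuousOn_rpolylog_half_one 1).add (continuousOn_rpolylog_one_sub 1)).add
      (continuousOn_rpolylog_one_sub_inv 1)).sub ((continuousOn_log_half_one.pow 3).div_const 6)).sub
      (continuousOn_const.mul continuousOn_log_half_one)).add
      ((continuous_log_mul_log_one_sub.continuousOn.mul continuousOn_log_half_one).div_const 2))
    (fun x hx => by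
      have hx0 : 0 < x := by linarith [hx.1]
      have hx1 := sub_pos.2 hx.2
      have hx2 : x - 1 ≠ 0 := by linarith
      have hrefl := rpolylog_two_reflection (Ioo_subset_Icc_self hx)
      have hland := rpolylog_two_landen (Ioo_subset_Icc_self hx)
      have hlog := Real.hasDerivAt_log hx0.ne'
      refine ((((((hasDerivAt_rpolylog 2 (abs_lt.2 ⟨by linarith, hx.2⟩) hx0.ne').add
        ((hasDerivAt_rpolylog 2 (x := 1 - x) (abs_lt.2 ⟨by linarith, by linarith⟩)
          hx1.ne').comp_const_sub 1 x)).add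
        ((hasDerivAt_rpolylog 2 (abs_one_sub_inv_lt_one hx)
          (one_sub_inv_ne_zero hx)).comp x (hasDerivAt_one_sub_inv hx0.ne'))).sub
        ((hlog.pow 3).div_const 6)).sub (hlog.const_mul (Real.pi ^ 2 / 6))).add
        (((hlog.mul (hasDerivAt_log_one_sub hx.2)).mul hlog).div_const 2)).congr_deriv ?_
      rw [← hrefl, show rpolylog 2 (1 - x⁻¹) = -rpolylog 2 (1 - x) - Real.log x ^ 2 / 2 by linarith]
      simp only [Pi.mul_apply]
      rw [show 1 - x⁻¹ = (x - 1) / x by field_simp]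
      generalize rpolylog 2 (1 - x) = R
      generalize Real.log (1 - x) = b
      rw [show 1 - x = -(x - 1) by ring]
      field_simp
      ring) hx
  rw [h]
  simp [rpolylog_zero]

lemma rpolylog_two_half : rpolylog 2 (1 / 2) = Real.pi ^ 2 / 12 - Real.log 2 ^ 2 / 2 := by
  have h := rpolylog_two_reflection (x := 1 / 2) ⟨le_rfl, by norm_num⟩
  rw [show (1 : ℝ) - 1 / 2 = 1 / 2 by norm_num, log_half] at h
  linear_combination h / 2

lemma rpolylog_three_half : rpolylog 3 (1 / 2)
    = 7 / 8 * rpolylog 3 1 - Real.pi ^ 2 / 12 * Real.log 2 + Real.log 2 ^ 3 / 6 := by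
  have h := rpolylog_three_landen (x := 1 / 2) ⟨le_rfl, by norm_num⟩
  rw [show (1 : ℝ) - 1 / 2 = 1 / 2 by norm_num, show (1 : ℝ) - (1 / 2)⁻¹ = -1 by norm_num,
    log_half, rpolylog_three_neg_one] at h
  linear_combination h / 2

/-- A primitive of `(log (1 - t) - log t) * log t ^ 2 / (t * (1 - t))` on `[1/2, 1]`. -/
noncomputable def logSubLogPrimitive (t : ℝ) : ℝ :=
  2 * (rpolylog 2 t * Real.log t ^ 2) - 4 * (rpolylog 3 t * Real.log t) + 4 * rpolylog 4 t
    - Real.log t ^ 4 / 4 + (Real.log t * Real.log (1 - t)) * Real.log t ^ 2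
    - logLogSqPrimitive (1 - t)

lemma continuousOn_logSubLogPrimitive : ContinuousOn logSubLogPrimitive (Icc (1 / 2) 1) := by
  have hlog := continuousOn_log_half_one
  exact ((((((continuousOn_const.mul ((continuousOn_rpolylog_half_one 0).mul (hlog.pow 2))).sub
    (continuousOn_const.mul ((continuousOn_rpolylog_half_one 1).mul hlog))).add
    (continuousOn_const.mul (continuousOn_rpolylog_half_one 2))).sub
    ((hlog.pow 4).div_const 4)).add
    (continuous_log_mul_log_one_sub.continuousOn.mul (hlog.pow 2)))).sub
    continuousOn_logLogSqPrimitive_one_sub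

lemma hasDerivAt_logSubLogPrimitive {t : ℝ} (ht : t ∈ Ioo (0 : ℝ) 1) :
    HasDerivAt logSubLogPrimitive
      ((Real.log (1 - t) - Real.log t) * Real.log t ^ 2 / (t * (1 - t))) t := by
  have ht0 := ht.1.ne'
  have ht1 := (sub_pos.2 ht.2).ne'
  have hta : |t| < 1 := by rw [abs_of_pos ht.1]; exact ht.2
  have hlog := Real.hasDerivAt_log ht0
  refine (((((((hasDerivAt_rpolylog_two hta ht0).mul (hlog.pow 2)).const_mul 2).sub
    (((hasDerivAt_rpolylog 2 hta ht0).mul hlog).const_mul 4)).add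
    ((hasDerivAt_rpolylog 3 hta ht0).const_mul 4)).sub ((hlog.pow 4).div_const 4)).add
    ((hlog.mul (hasDerivAt_log_one_sub ht.2)).mul (hlog.pow 2)) |>.sub
    (hasDerivAt_logLogSqPrimitive_one_sub ht)).congr_deriv ?_
  simp only [Pi.mul_apply, Pi.pow_apply]
  field_simp
  ring

lemma hasDerivAt_logSubLogPrimitive_one_add_inv {x : ℝ} (hx : 0 < x) :
    HasDerivAt (fun x => logSubLogPrimitive (1 + x)⁻¹)
      (-(Real.log x * Real.log (1 + x) ^ 2 / x)) x := by
  have h1 : 0 < 1 + x := by linarith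
  have ht : (1 + x)⁻¹ ∈ Ioo (0 : ℝ) 1 := ⟨inv_pos.2 h1, inv_lt_one_of_one_lt₀ (by linarith)⟩
  have hi : HasDerivAt (fun x : ℝ => (1 + x)⁻¹) (-1 / (1 + x) ^ 2) x :=
    ((hasDerivAt_id x).const_add 1).inv h1.ne'
  refine ((hasDerivAt_logSubLogPrimitive ht).comp x hi).congr_deriv ?_
  rw [show 1 - (1 + x)⁻¹ = x / (1 + x) by field_simp; ring, Real.log_div hx.ne' h1.ne',
    Real.log_inv]
  field_simp
  ring

/-- A primitive of `log x * log (1 - x) * log (1 + x) / x` on `[0, 1]`. -/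
noncomputable def logLogLogPrimitive (x : ℝ) : ℝ :=
  (logLogSqPrimitive (x ^ 2) / 4 - logLogSqPrimitive x + logSubLogPrimitive (1 + x)⁻¹) / 2

lemma continuousOn_logLogLogPrimitive : ContinuousOn logLogLogPrimitive (Icc 0 1) := by
  refine (((ContinuousOn.comp continuousOn_logLogSqPrimitive (by fun_prop)
    fun x hx => ⟨sq_nonneg x, pow_le_one₀ hx.1 hx.2⟩).div_const 4).sub
    continuousOn_logLogSqPrimitive).add
    (continuousOn_logSubLogPrimitive.comp
      (ContinuousOn.inv₀ (by fun_prop) fun x hx => ?_) fun x hx => ⟨?_, ?_⟩) |>.div_const 2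
  · linarith [hx.1]
  · rw [one_div]
    exact inv_anti₀ (by linarith [hx.1]) (by linarith [hx.2])
  · exact inv_le_one_of_one_le₀ (by linarith [hx.1])

lemma hasDerivAt_logLogLogPrimitive {x : ℝ} (hx : x ∈ Ioo (0 : ℝ) 1) :
    HasDerivAt logLogLogPrimitive
      (Real.log x * Real.log (1 - x) * Real.log (1 + x) / x) x := by
  have hx0 := hx.1.ne'
  have h1 : 1 - x ≠ 0 := (sub_pos.2 hx.2).ne'
  have h2 : 1 + x ≠ 0 := by linarith [hx.1]
  have hsq : x ^ 2 ∈ Ioo (0 : ℝ) 1 := ⟨pow_pos hx.1 2, pow_lt_one₀ hx.1.le hx.2 two_ne_zero⟩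
  have hcomp := HasDerivAt.comp (h := fun x : ℝ => x ^ 2) x (hasDerivAt_logLogSqPrimitive hsq)
    (hasDerivAt_pow 2 x)
  refine (((hcomp.div_const 4).sub
    (hasDerivAt_logLogSqPrimitive hx)).add
    (hasDerivAt_logSubLogPrimitive_one_add_inv hx.1) |>.div_const 2).congr_deriv ?_
  rw [show 1 - x ^ 2 = (1 - x) * (1 + x) by ring, Real.log_mul h1 h2, Real.log_pow]
  field_simp
  ring

lemma integral_log_mul_log_one_sub_mul_log_one_add_div :
    ∫ x in (0 : ℝ)..1, Real.log x * Real.log (1 - x) * Real.log (1 + x) / x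
      = logLogLogPrimitive 1 - logLogLogPrimitive 0 := by
  refine intervalIntegral.integral_eq_sub_of_hasDerivAt_of_le zero_le_one
    continuousOn_logLogLogPrimitive (fun x hx => hasDerivAt_logLogLogPrimitive hx) ?_
  rw [intervalIntegrable_iff_integrableOn_Ioc_of_le zero_le_one]
  refine intervalIntegral.integrableOn_deriv_of_nonneg continuousOn_logLogLogPrimitive
    (fun x hx => hasDerivAt_logLogLogPrimitive hx) fun x hx => ?_
  have h1 : Real.log x ≤ 0 := Real.log_nonpos hx.1.le hx.2.le
  have h2 : Real.log (1 - x) ≤ 0 := Real.log_nonpos (by linarith [hx.2]) (by linarith [hx.1])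
  have h3 : 0 ≤ Real.log (1 + x) := Real.log_nonneg (by linarith [hx.1])
  exact div_nonneg (mul_nonneg (mul_nonneg_of_nonpos_of_nonpos h1 h2) h3) hx.1.le

lemma logSubLogPrimitive_one : logSubLogPrimitive 1 = 4 * (Real.pi ^ 4 / 90) := by
  simp [logSubLogPrimitive, rpolylog_four_one, logLogSqPrimitive_zero]

lemma logSubLogPrimitive_half : logSubLogPrimitive (1 / 2)
    = 4 * rpolylog 4 (1 / 2) + 7 / 2 * rpolylog 3 1 * Real.log 2 + Real.log 2 ^ 4 / 6
      - Real.pi ^ 2 / 6 * Real.log 2 ^ 2 + Real.pi ^ 4 / 360 := by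
  rw [logSubLogPrimitive, show (1 : ℝ) - 1 / 2 = 1 / 2 by norm_num, log_half, rpolylog_two_half,
    rpolylog_three_half, logLogSqPrimitive_half]
  ring

lemma logLogLogPrimitive_one_sub_logLogLogPrimitive_zero : logLogLogPrimitive 1 - logLogLogPrimitive 0
    = 2 * rpolylog 4 (1 / 2) + 7 / 4 * rpolylog 3 1 * Real.log 2 - 3 * Real.pi ^ 4 / 160
      + Real.log 2 ^ 4 / 12 - Real.pi ^ 2 * Real.log 2 ^ 2 / 12 := by
  rw [logLogLogPrimitive, logLogLogPrimitive, show ((1 : ℝ) + 1)⁻¹ = 1 / 2 by norm_num,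
    show ((1 : ℝ) + 0)⁻¹ = 1 by norm_num, one_pow, zero_pow two_ne_zero, logSubLogPrimitive_one,
    logSubLogPrimitive_half, logLogSqPrimitive_one, logLogSqPrimitive_zero]
  ring

/-- `∫₀¹ log x · log(1−x) · log(1+x)/x dx
= 2·Li₄(1/2) + (7/4)ζ(3)·log 2 − 3π⁴/160 + log⁴2/12 − π²·log²2/12`. -/
theorem statement13 :
    ((∫ x in (0 : ℝ)..1, Real.log x * Real.log (1 - x) * Real.log (1 + x) / x : ℝ) : ℂ)
      = 2 * (rpolylog 4 (1 / 2) : ℂ) + 7 / 4 * riemannZeta 3 * (Real.log 2 : ℂ)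
        - 3 * (Real.pi : ℂ) ^ 4 / 160 + (Real.log 2 : ℂ) ^ 4 / 12
        - (Real.pi : ℂ) ^ 2 * (Real.log 2 : ℂ) ^ 2 / 12 := by
  rw [integral_log_mul_log_one_sub_mul_log_one_add_div, logLogLogPrimitive_one_sub_logLogLogPrimitive_zero,
    riemannZeta_three_eq_rpolylog]
  push_cast
  rfl
end
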